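/- arXiv:1909.02516 — 13 statements merged into one kernel-verified Lean document; each statement's English description precedes it below -/
import Mathlib

section
/- Let k ≥ 2, k ≤ n₁ < n₂ and Q = n₁, and let (F, {B_M}) be an (n₁, n₂, k, c=1) tiered gradient code whose columns are indexed by ℤ/n₁ℤ and in which the support of the i-th row f_i of F equals the cyclic interval L_i = {i−1, i, …, i−1+(n₁−k)} (mod n₁). Fix m ∈ {1,…,n₁} and let Z_j denote the support of the j-th row of B_{{m}}. Then (ℤ/n₁ℤ) \ L_m ⊆ Z_j for every j ∈ {1,…,n₂−n₁}. -/
/-- A vector in the span of vectors vanishing at `x` vanishes at `x`. -/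
theorem apply_eq_zero_of_mem_span {ι R : Type*} [Semiring R] {S : Set (ι → R)} {x : ι}
    (hS : ∀ v ∈ S, v x = 0) {w : ι → R} (hw : w ∈ Submodule.span R S) : w x = 0 := by
  have hle : Submodule.span R S ≤ LinearMap.ker (LinearMap.proj x : (ι → R) →ₗ[R] R) :=
    Submodule.span_le.2 hS
  exact hle hw

open Classical in
/-- A residue lies in at most `d + 1` of the cyclic intervals `{i, …, i + d}`. -/
theorem card_cyclic_interval_mem_le (n d : ℕ) (x : ZMod n) :
    (Finset.univ.filter fun i : Fin n =>
      ∃ r : ℕ, r ≤ d ∧ x = (i.val : ZMod n) + (r : ZMod n)).card ≤ d + 1 := by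
  rcases Nat.eq_zero_or_pos n with rfl | hn
  · simp
  have : NeZero n := ⟨hn.ne'⟩
  calc
    _ ≤ ((Finset.range (d + 1)).image
        fun r : ℕ => (⟨(x - (r : ZMod n)).val, ZMod.val_lt _⟩ : Fin n)).card := by
      refine Finset.card_le_card fun i hi => ?_
      obtain ⟨r, hr, rfl⟩ := (Finset.mem_filter.1 hi).2
      refine Finset.mem_image.2 ⟨r, Finset.mem_range.2 (by omega), Fin.ext ?_⟩
      simp [ZMod.val_natCast, Nat.mod_eq_of_lt i.isLt]
    _ ≤ d + 1 := Finset.card_image_le.trans_eq (Finset.card_range _)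


/-- In an `(n₁, n₂, k, c = 1)` tiered gradient code whose `F`-rows have the
cyclic supports `L_i`, if server `m` finishes first then every row of `B_{{m}}` must be
nonzero on all coordinates outside `L_m`. -/
theorem stmt_3 (n₁ n₂ k : ℕ) (hk : 2 ≤ k) (hkn : k ≤ n₁) (hn : n₁ < n₂)
    (L : Fin n₁ → Set (ZMod n₁))
    (hL : ∀ i : Fin n₁,
      L i = {x : ZMod n₁ | ∃ r : ℕ, r ≤ n₁ - k ∧ x = (i.val : ZMod n₁) + (r : ZMod n₁)})
    (F : Matrix (Fin n₁) (ZMod n₁) ℝ)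
    (B : Finset (Fin n₁) → Matrix (Fin (n₂ - n₁)) (ZMod n₁) ℝ)
    (hsuppF : ∀ (i : Fin n₁) (x : ZMod n₁), F i x ≠ 0 ↔ x ∈ L i)
    (hspan : ∀ M : Finset (Fin n₁), M.card = 1 →
      ∀ I₁ : Finset (Fin n₁), Disjoint I₁ M →
        ∀ I₂ : Finset (Fin (n₂ - n₁)), I₁.card + I₂.card = k - 1 →
          (fun _ => (1 : ℝ)) ∈ Submodule.span ℝ
            ({v : ZMod n₁ → ℝ | ∃ i ∈ M ∪ I₁, v = F i} ∪
             {v : ZMod n₁ → ℝ | ∃ j ∈ I₂, v = B M j})) :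
    ∀ (m : Fin n₁) (j : Fin (n₂ - n₁)) (x : ZMod n₁),
      x ∉ L m → B {m} j x ≠ 0 := by
  classical
  intro m j x hx hB
  have hcard : (Finset.univ.filter fun i => x ∈ L i).card ≤ n₁ - k + 1 := by
    simpa [hL] using card_cyclic_interval_mem_le n₁ (n₁ - k) x
  have hsum := Finset.card_filter_add_card_filter_not
    (s := (Finset.univ : Finset (Fin n₁))) (fun i => x ∈ L i)
  rw [Finset.card_univ, Fintype.card_fin] at hsum
  have herase : ((Finset.univ.filter fun i => x ∉ L i).erase m).card =
      (Finset.univ.filter fun i => x ∉ L i).card - 1 :=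
    Finset.card_erase_of_mem (by simpa using hx)
  obtain ⟨I, hI, hIcard⟩ := Finset.exists_subset_card_eq
    (show k - 2 ≤ ((Finset.univ.filter fun i => x ∉ L i).erase m).card by omega)
  have hone := hspan {m} (Finset.card_singleton m) I
    (Finset.disjoint_singleton_right.2 fun h => Finset.notMem_erase m _ (hI h)) {j}
    (by rw [hIcard, Finset.card_singleton]; omega)
  refine one_ne_zero (apply_eq_zero_of_mem_span (x := x) ?_ hone)
  rintro v (⟨i, hi, rfl⟩ | ⟨j', hj', rfl⟩)
  · have hxi : x ∉ L i := by
      rcases Finset.mem_union.1 hi with h | h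
      · rwa [Finset.mem_singleton.1 h]
      · simpa using Finset.mem_of_mem_erase (hI h)
    exact not_not.1 fun h => hxi ((hsuppF i x).1 h)
  · rwa [Finset.mem_singleton.1 hj']
end

section
/- Let k ≥ 2, 1 ≤ c < k, k ≤ n₁ ≤ 2(k−1), n₂ > n₁, and Q = 2(k−1). Put h = ⌈n₁/2⌉. Define F ∈ ℝ^{n₁×Q} by: for i ≤ h, f_i equals 1 on coordinates 1,…,k−1 and 0 elsewhere; for i > h, f_i equals 1 on coordinates k,…,2(k−1) and 0 elsewhere. For each c-element subset M ⊆ {1,…,n₁}, let every row of B_M ∈ ℝ^{(n₂−n₁)×Q} equal 1 on coordinates k,…,2(k−1) and 0 elsewhere if M ⊆ {1,…,h}, and equal 1 on coordinates 1,…,k−1 and 0 elsewhere otherwise. Then (F, {B_M}) is an (n₁, n₂, k, c) tiered gradient code, i.e., the span condition holds. -/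
theorem Fin.exists_mem_le_val_of_lt_card {n h : ℕ} {S : Finset (Fin n)} (hS : h < S.card) :
    ∃ i ∈ S, h ≤ i.val := by
  by_contra! hlt
  have := Finset.card_le_card_of_injOn (t := Finset.range h) Fin.val
    (fun i hi => by simpa using hlt i hi) Fin.val_injective.injOn
  rw [Finset.card_range] at this
  omega

theorem Fin.exists_mem_val_lt_of_lt_card {n h : ℕ} {S : Finset (Fin n)} (hS : n - h < S.card) :
    ∃ i ∈ S, i.val < h := by
  by_contra! hle
  have := Finset.card_le_card_of_injOn (t := Finset.Ico h n) Fin.val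
    (fun i hi => by simpa using ⟨hle i hi, i.isLt⟩) Fin.val_injective.injOn
  rw [Nat.card_Ico] at this
  omega


/-- The fractional-repetition construction (Construction 1) is an
`(n₁, n₂, k, c)` tiered gradient code for `k ≤ n₁ ≤ 2(k-1)`.  Servers are `0`-indexed:
server `i` (1-indexed) corresponds to `i.val = i - 1`, the first half is
`{i | i.val < ⌈n₁/2⌉}`, and coordinates `1,…,k-1` (resp. `k,…,2(k-1)`) correspond to
`q.val < k-1` (resp. `k-1 ≤ q.val`). -/
theorem stmt_4 (n₁ n₂ k c : ℕ) (hk : 2 ≤ k) (hc : 1 ≤ c) (hck : c < k)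
    (hkn : k ≤ n₁) (hn₁ : n₁ ≤ 2 * (k - 1)) (hn : n₁ < n₂)
    (F : Matrix (Fin n₁) (Fin (2 * (k - 1))) ℝ)
    (B : Finset (Fin n₁) → Matrix (Fin (n₂ - n₁)) (Fin (2 * (k - 1))) ℝ)
    (hF : ∀ (i : Fin n₁) (q : Fin (2 * (k - 1))), F i q =
      if (i.val < (n₁ + 1) / 2 ∧ q.val < k - 1) ∨ ((n₁ + 1) / 2 ≤ i.val ∧ k - 1 ≤ q.val)
      then 1 else 0)
    (hB : ∀ (M : Finset (Fin n₁)) (j : Fin (n₂ - n₁)) (q : Fin (2 * (k - 1))),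
      B M j q =
        if ∀ i ∈ M, i.val < (n₁ + 1) / 2
        then (if k - 1 ≤ q.val then 1 else 0)
        else (if q.val < k - 1 then 1 else 0)) :
    ∀ M : Finset (Fin n₁), M.card = c →
      ∀ I₁ : Finset (Fin n₁), Disjoint I₁ M →
        ∀ I₂ : Finset (Fin (n₂ - n₁)), I₁.card + I₂.card = k - c →
          (fun _ => (1 : ℝ)) ∈ Submodule.span ℝ
            ({v : Fin (2 * (k - 1)) → ℝ | ∃ i ∈ M ∪ I₁, v = F i} ∪
             {v : Fin (2 * (k - 1)) → ℝ | ∃ j ∈ I₂, v = B M j}) := by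
  intro M hM I₁ hdisj I₂ hcard
  have of_pair : ∀ {S : Set (Fin (2 * (k - 1)) → ℝ)} {u v : Fin (2 * (k - 1)) → ℝ},
      u ∈ S → v ∈ S → (∀ q, u q + v q = 1) → (fun _ => (1 : ℝ)) ∈ Submodule.span ℝ S := by
    intro S u v hu hv huv
    rw [← show u + v = fun _ => (1 : ℝ) from funext huv]
    exact Submodule.add_mem _ (Submodule.subset_span hu) (Submodule.subset_span hv)
  rcases I₂.eq_empty_or_nonempty with rfl | ⟨j, hj⟩
  · have hU : (M ∪ I₁).card = k := by
      rw [Finset.card_union_of_disjoint hdisj.symm]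
      rw [Finset.card_empty] at hcard
      omega
    obtain ⟨a, ha, hah⟩ : ∃ a ∈ M ∪ I₁, a.val < (n₁ + 1) / 2 :=
      Fin.exists_mem_val_lt_of_lt_card (by omega)
    obtain ⟨b, hb, hbh⟩ : ∃ b ∈ M ∪ I₁, (n₁ + 1) / 2 ≤ b.val :=
      Fin.exists_mem_le_val_of_lt_card (by omega)
    refine of_pair (Or.inl ⟨a, ha, rfl⟩) (Or.inl ⟨b, hb, rfl⟩) fun q => ?_
    rw [hF, hF]
    by_cases hq : q.val < k - 1
    · simp [-tsub_le_iff_right, hq, hq.not_ge, hah, hbh]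
    · simp [hq, hah, hbh, not_lt.mp hq]
  · by_cases hall : ∀ i ∈ M, i.val < (n₁ + 1) / 2
    · obtain ⟨a, ha⟩ : M.Nonempty := Finset.card_pos.mp (by omega)
      have hah := hall a ha
      refine of_pair (Or.inl ⟨a, Finset.mem_union_left _ ha, rfl⟩) (Or.inr ⟨j, hj, rfl⟩)
        fun q => ?_
      rw [hF, hB, if_pos hall]
      by_cases hq : q.val < k - 1
      · simp [-tsub_le_iff_right, hq, hq.not_ge, hah]
      · simp [hq, hah, not_lt.mp hq]
    · obtain ⟨b, hb, hbh⟩ : ∃ b ∈ M, (n₁ + 1) / 2 ≤ b.val := by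
        simpa using hall
      refine of_pair (Or.inl ⟨b, Finset.mem_union_left _ hb, rfl⟩) (Or.inr ⟨j, hj, rfl⟩)
        fun q => ?_
      rw [hF, hB, if_neg hall]
      by_cases hq : q.val < k - 1
      · simp [-tsub_le_iff_right, hq, hq.not_ge, hbh]
      · simp [hq, hbh, not_lt.mp hq]
end

section
/- Let k ≥ 2, 1 ≤ c < k, k ≤ n₁ ≤ 2(k−1) and n₂ > 2(k−1) with n₂ > n₁. Then there exists an (n₁, n₂, k, c) tiered gradient code with Q = 2(k−1) data partitions in which every row of F and every row of each B_M has support of size exactly k−1; hence its computation per server equals (k−1)/(2(k−1)) = 1/2, which is strictly less than the fraction (n₂−k+1)/n₂ required by the (n₂, k) gradient code. -/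
/-- The indicator row of the first half (`p`) or of the second half (`¬p`) of `2 * m` columns. -/
noncomputable def halfRow (m : ℕ) (p : Prop) : Fin (2 * m) → ℝ :=
  open Classical in fun q => if ((q : ℕ) < m ↔ p) then 1 else 0

lemma halfRow_add_halfRow_not (m : ℕ) (p : Prop) :
    halfRow m p + halfRow m (¬p) = fun _ => 1 := by
  funext q
  by_cases hp : p <;> by_cases hq : (q : ℕ) < m <;> simp [halfRow, hp, hq]

lemma card_filter_lt_half (m : ℕ) :
    (Finset.univ.filter fun q : Fin (2 * m) => (q : ℕ) < m).card = m := by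
  rw [Fin.card_filter_val_lt]
  omega

lemma card_support_halfRow (m : ℕ) (p : Prop) :
    (Finset.univ.filter fun q => halfRow m p q ≠ 0).card = m := by
  have h := card_filter_lt_half m
  by_cases hp : p
  · simpa [halfRow, hp] using h
  · have hs := Finset.card_filter_add_card_filter_not
      (s := Finset.univ) (fun q : Fin (2 * m) => (q : ℕ) < m)
    rw [h, Finset.card_univ, Fintype.card_fin] at hs
    simp only [halfRow, hp, iff_false, ne_eq, ite_eq_right_iff, one_ne_zero, imp_false, not_not]
    omega

/-- More than `m` indices below `2 * m` meet both halves. -/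
lemma exists_lt_and_exists_le_of_lt_card {n m : ℕ} (hn : n ≤ 2 * m) {S : Finset (Fin n)}
    (hS : m < S.card) : (∃ i ∈ S, (i : ℕ) < m) ∧ ∃ i ∈ S, ¬(i : ℕ) < m := by
  have hcard (a : ℕ) (h : ∀ i ∈ S, (i : ℕ) ∈ Finset.Ico a (a + m)) : False := by
    have := Finset.card_le_card_of_injOn (t := Finset.Ico a (a + m)) (fun i : Fin n => (i : ℕ))
      h Fin.val_injective.injOn
    rw [Nat.card_Ico] at this
    omega
  constructor <;> by_contra! h
  · exact hcard m fun i hi => Finset.mem_Ico.2 ⟨h i hi, by have := i.isLt; omega⟩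
  · exact hcard 0 fun i hi => Finset.mem_Ico.2 ⟨Nat.zero_le _, by have := h i hi; omega⟩

/-- A span that contains both half rows contains the all-ones row. -/
lemma ones_mem_span_of_halfRow_mem {m : ℕ} {p : Prop} {S : Set (Fin (2 * m) → ℝ)}
    (h : halfRow m p ∈ S) (h' : halfRow m (¬p) ∈ S) :
    (fun _ => (1 : ℝ)) ∈ Submodule.span ℝ S := by
  rw [← halfRow_add_halfRow_not m p]
  exact add_mem (Submodule.subset_span h) (Submodule.subset_span h')


/-- For `k ≤ n₁ ≤ 2(k-1) < n₂` there exists an `(n₁, n₂, k, c)` tiered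
gradient code with `Q = 2(k-1)` partitions in which every row has support of size
exactly `k - 1`; its computation per server `(k-1)/(2(k-1)) = 1/2` is strictly smaller
than the fraction `(n₂-k+1)/n₂` of the `(n₂, k)` gradient code. -/
theorem stmt_5 (n₁ n₂ k c : ℕ) (hk : 2 ≤ k) (hc : 1 ≤ c) (hck : c < k)
    (hkn : k ≤ n₁) (hn₁ : n₁ ≤ 2 * (k - 1)) (hn₂ : 2 * (k - 1) < n₂) (hn : n₁ < n₂) :
    ∃ (F : Matrix (Fin n₁) (Fin (2 * (k - 1))) ℝ)
      (B : Finset (Fin n₁) → Matrix (Fin (n₂ - n₁)) (Fin (2 * (k - 1))) ℝ),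
      (∀ M : Finset (Fin n₁), M.card = c →
        ∀ I₁ : Finset (Fin n₁), Disjoint I₁ M →
          ∀ I₂ : Finset (Fin (n₂ - n₁)), I₁.card + I₂.card = k - c →
            (fun _ => (1 : ℝ)) ∈ Submodule.span ℝ
              ({v : Fin (2 * (k - 1)) → ℝ | ∃ i ∈ M ∪ I₁, v = F i} ∪
               {v : Fin (2 * (k - 1)) → ℝ | ∃ j ∈ I₂, v = B M j})) ∧
      (∀ i : Fin n₁, (Finset.univ.filter fun q => F i q ≠ 0).card = k - 1) ∧
      (∀ M : Finset (Fin n₁), M.card = c → ∀ j : Fin (n₂ - n₁),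
        (Finset.univ.filter fun q => B M j q ≠ 0).card = k - 1) ∧
      ((k : ℝ) - 1) / (2 * ((k : ℝ) - 1)) = 1 / 2 ∧
      (1 : ℝ) / 2 < ((n₂ : ℝ) - (k : ℝ) + 1) / (n₂ : ℝ) := by
  refine ⟨fun i => halfRow (k - 1) ((i : ℕ) < k - 1),
    fun M _ => halfRow (k - 1) (¬∃ h : M.Nonempty, (h.choose : ℕ) < k - 1),
    ?_, fun i => card_support_halfRow _ _, fun M _ j => card_support_halfRow _ _, ?_, ?_⟩
  · intro M hM I₁ hdisj I₂ hcard
    have hne : M.Nonempty := Finset.card_pos.1 (by omega)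
    rcases I₂.eq_empty_or_nonempty with rfl | ⟨j, hj⟩
    · have hU : k - 1 < (M ∪ I₁).card := by
        rw [Finset.card_union_of_disjoint hdisj.symm]
        simp only [Finset.card_empty] at hcard
        omega
      obtain ⟨⟨i, hi, hlt⟩, i', hi', hge⟩ := exists_lt_and_exists_le_of_lt_card hn₁ hU
      refine ones_mem_span_of_halfRow_mem (p := True) (.inl ⟨i, hi, ?_⟩) (.inl ⟨i', hi', ?_⟩)
      · simp only [hlt]
      · simp only [hge, not_true_eq_false]
    · refine ones_mem_span_of_halfRow_mem (p := (hne.choose : ℕ) < k - 1)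
        (.inl ⟨hne.choose, Finset.mem_union_left _ hne.choose_spec, rfl⟩) (.inr ⟨j, hj, ?_⟩)
      simp only [hne, exists_true_left]
  · have : (k : ℝ) - 1 ≠ 0 := by
      have : (2 : ℝ) ≤ k := by exact_mod_cast hk
      linarith
    field_simp
  · have h : 2 * k < n₂ + 2 := by omega
    have h' : (2 : ℝ) * k < n₂ + 2 := by exact_mod_cast h
    have hpos : (0 : ℝ) < n₂ := by exact_mod_cast (by omega : 0 < n₂)
    rw [lt_div_iff₀ hpos]
    linarith
end

section
/- Let n ≥ k ≥ 1 be integers and for i ∈ {1,…,n} let L_i = {i−1, i, …, i−1+(n−k)} (mod n) ⊆ ℤ/nℤ. Then for every nonempty subset T ⊆ {1,…,n} with |T| = ℓ ≤ k, the union ⋃_{i∈T} L_i has at least (n−k) + ℓ elements. -/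
/-- A nonempty subset of `ℤ/nℤ` closed under adding `1` is everything. -/
theorem ZMod.eq_univ_of_add_one_mem {n : ℕ} [NeZero n] {A : Set (ZMod n)} (hA : A.Nonempty)
    (h : ∀ x ∈ A, x + 1 ∈ A) : A = Set.univ := by
  obtain ⟨a, ha⟩ := hA
  have key : ∀ m : ℕ, a + (m : ZMod n) ∈ A := by
    intro m
    induction m with
    | zero => simpa using ha
    | succ m ih => simpa [add_assoc] using h _ ih
  refine Set.eq_univ_of_forall fun x => ?_
  simpa using key (x - a).val

/-- Adding the interval `{0, …, m}` to a nonempty subset of `ℤ/nℤ` enlarges it by at least `m`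
elements, unless the result is everything. -/
theorem ZMod.min_le_ncard_add_interval {n : ℕ} [NeZero n] {S : Set (ZMod n)} (hS : S.Nonempty)
    (m : ℕ) :
    min n (S.ncard + m) ≤ {x : ZMod n | ∃ s ∈ S, ∃ r : ℕ, r ≤ m ∧ x = s + (r : ZMod n)}.ncard := by
  induction m with
  | zero =>
    refine (min_le_right _ _).trans (Set.ncard_le_ncard (fun s hs => ?_) (Set.toFinite _))
    exact ⟨s, hs, 0, le_rfl, by simp⟩
  | succ m ih =>
    set A := {x : ZMod n | ∃ s ∈ S, ∃ r : ℕ, r ≤ m ∧ x = s + (r : ZMod n)} with hA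
    set B := {x : ZMod n | ∃ s ∈ S, ∃ r : ℕ, r ≤ m + 1 ∧ x = s + (r : ZMod n)} with hB
    have hAB : A ⊆ B := fun x ⟨s, hs, r, hr, hx⟩ => ⟨s, hs, r, by omega, hx⟩
    have hAB' : ∀ x ∈ A, x + 1 ∈ B := by
      rintro x ⟨s, hs, r, hr, rfl⟩
      exact ⟨s, hs, r + 1, by omega, by push_cast; ring⟩
    by_cases h : ∀ x ∈ A, x + 1 ∈ A
    · have hne : A.Nonempty := by
        obtain ⟨s, hs⟩ := hS
        exact ⟨s, s, hs, 0, Nat.zero_le _, by simp⟩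
      have hu : B = Set.univ :=
        Set.univ_subset_iff.mp (ZMod.eq_univ_of_add_one_mem hne h ▸ hAB)
      rw [hu, Set.ncard_univ, Nat.card_zmod]
      exact min_le_left _ _
    · push Not at h
      obtain ⟨x, hx, hx'⟩ := h
      have hins : (insert (x + 1) A).ncard ≤ B.ncard :=
        Set.ncard_le_ncard (Set.insert_subset (hAB' x hx) hAB) (Set.toFinite _)
      rw [Set.ncard_insert_of_notMem hx' (Set.toFinite _)] at hins
      omega

/-- The union of any `ℓ ≤ k` of the cyclic supports `L_i` has at least
`(n - k) + ℓ` elements. -/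
theorem stmt_7 (n k : ℕ) (hk : 1 ≤ k) (hkn : k ≤ n)
    (L : Fin n → Set (ZMod n))
    (hL : ∀ i : Fin n,
      L i = {x : ZMod n | ∃ r : ℕ, r ≤ n - k ∧ x = (i.val : ZMod n) + (r : ZMod n)})
    (T : Finset (Fin n)) (hT : T.Nonempty) (ℓ : ℕ) (hcard : T.card = ℓ) (hℓk : ℓ ≤ k) :
    (n - k) + ℓ ≤ (⋃ i ∈ T, L i).ncard := by
  have : NeZero n := ⟨by omega⟩
  let f : Fin n → ZMod n := fun i => (i.val : ZMod n)
  have hf : Function.Injective f := fun i j hij => by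
    have h := congrArg ZMod.val hij
    simp only [f, ZMod.val_cast_of_lt i.isLt, ZMod.val_cast_of_lt j.isLt] at h
    exact Fin.ext h
  have hS : (f '' (T : Set (Fin n))).ncard = ℓ := by
    rw [Set.ncard_image_of_injective _ hf, Set.ncard_coe_finset, hcard]
  have hU : (⋃ i ∈ T, L i) =
      {x : ZMod n | ∃ s ∈ f '' (T : Set (Fin n)), ∃ r : ℕ, r ≤ n - k ∧ x = s + (r : ZMod n)} := by
    ext x
    simp [hL, f]
  have h := ZMod.min_le_ncard_add_interval (hT.to_set.image f) (n - k)
  rw [hU]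
  omega
end

section
/- Let n and k be integers with n > 2(k−1) and k ≥ 1, and for i ∈ {1,…,n} let L_i = {i−1, i, …, i−1+(n−k)} (mod n) ⊆ ℤ/nℤ. Then for every nonempty subset T ⊆ {1,…,n}, the complement (ℤ/nℤ) \ ⋃_{i∈T} L_i is a set of cyclically consecutive residues: it equals {t, t+1, …, t+g−1} (mod n) for some t ∈ ℤ/nℤ and some integer g ≥ 0 (the empty set when g = 0). -/
/-- Membership in the cyclic interval `{a, a + 1, …, a + m}` of `ZMod n`, in terms of `ZMod.val`. -/
lemma ZMod.exists_eq_add_natCast_iff_val_le {n : ℕ} [NeZero n] {m : ℕ} (hm : m < n)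
    (a x : ZMod n) : (∃ r : ℕ, r ≤ m ∧ x = a + (r : ZMod n)) ↔ (x - a).val ≤ m := by
  constructor
  · rintro ⟨r, hr, rfl⟩
    rwa [add_sub_cancel_left, ZMod.val_natCast_of_lt (by omega)]
  · intro h
    exact ⟨(x - a).val, h, by simp⟩

/-- Translates by `p ≤ q ≤ r` of an element: if the first and last representatives exceed `m` and
`r - p ≤ m`, then there is no wrap-around in between, so the middle representative exceeds `m`. -/
lemma ZMod.lt_val_add_natCast_of_le_of_le {n : ℕ} [NeZero n] {m p q r : ℕ}
    (hpq : p ≤ q) (hqr : q ≤ r) (hrp : r ≤ p + m) (hmn : m < n) (y : ZMod n)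
    (hp : m < (y + (p : ZMod n)).val) (hr : m < (y + (r : ZMod n)).val) :
    m < (y + (q : ZMod n)).val := by
  obtain ⟨d, rfl⟩ := Nat.exists_eq_add_of_le hpq
  obtain ⟨e, rfl⟩ := Nat.exists_eq_add_of_le hqr
  push_cast at hr ⊢
  rw [add_assoc (p : ZMod n), ← add_assoc y, ← Nat.cast_add, ZMod.val_add,
    ZMod.val_natCast_of_lt (by omega)] at hr
  rw [← add_assoc, ZMod.val_add, ZMod.val_natCast_of_lt (by omega)]
  have hlt := ZMod.val_lt (y + (p : ZMod n))
  set v := (y + (p : ZMod n)).val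
  have hno : v + (d + e) < n := by
    by_contra! h
    rw [Nat.mod_eq_sub_mod h, Nat.mod_eq_of_lt (by omega)] at hr
    omega
  rw [Nat.mod_eq_of_lt (by omega)]
  omega

/-- A bounded order-connected set of natural numbers is an interval `{a, …, a + g - 1}`. -/
lemma Set.OrdConnected.exists_eq_Ico_add {S : Set ℕ} (hS : S.OrdConnected) (hb : BddAbove S) :
    ∃ a g : ℕ, S = Set.Ico a (a + g) := by
  rcases S.eq_empty_or_nonempty with rfl | hne
  · exact ⟨0, 0, by simp⟩
  refine ⟨sInf S, sSup S + 1 - sInf S, Set.ext fun x => ⟨fun hx => ?_, fun hx => ?_⟩⟩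
  · have h₁ := Nat.sInf_le hx
    have h₂ := le_csSup hb hx
    exact ⟨h₁, by omega⟩
  · obtain ⟨h₁, h₂⟩ := hx
    exact hS.out (Nat.sInf_mem hne) (Nat.sSup_mem hne hb) ⟨h₁, by omega⟩

/-- For `n > 2(k-1)`, the complement of a union of cyclic supports `L_i`
is a set of cyclically consecutive residues. -/
theorem stmt_8 (n k : ℕ) (hk : 1 ≤ k) (hn : 2 * (k - 1) < n)
    (L : Fin n → Set (ZMod n))
    (hL : ∀ i : Fin n,
      L i = {x : ZMod n | ∃ r : ℕ, r ≤ n - k ∧ x = (i.val : ZMod n) + (r : ZMod n)})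
    (T : Finset (Fin n)) (hT : T.Nonempty) :
    ∃ (t : ZMod n) (g : ℕ),
      (Set.univ \ ⋃ i ∈ T, L i) =
        {x : ZMod n | ∃ r : ℕ, r < g ∧ x = t + (r : ZMod n)} := by
  have : NeZero n := ⟨by omega⟩
  obtain ⟨i₀, hi₀⟩ := hT
  have hmem (x : ZMod n) : x ∈ Set.univ \ ⋃ i ∈ T, L i ↔
      ∀ i ∈ T, n - k < (x - (i.val : ZMod n)).val := by
    simp only [hL, Set.mem_sdiff, Set.mem_univ, true_and, Set.mem_iUnion, Set.mem_ofPred_eq,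
      ZMod.exists_eq_add_natCast_iff_val_le (show n - k < n by omega), not_exists, not_le,
      exists_prop, not_and]
  let S : Set ℕ :=
    {v | v < n ∧ ∀ i ∈ T, n - k < ((i₀.val : ZMod n) - (i.val : ZMod n) + (v : ZMod n)).val}
  have hlow {v : ℕ} (hv : v ∈ S) : n - k < v := by
    simpa [ZMod.val_natCast_of_lt hv.1] using hv.2 i₀ hi₀
  have hconn : S.OrdConnected := by
    refine ⟨fun p hp r hr q hq => ⟨hq.2.trans_lt hr.1, fun i hi => ?_⟩⟩
    have hp₀ := hlow hp
    have hr₀ := hr.1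
    exact ZMod.lt_val_add_natCast_of_le_of_le hq.1 hq.2 (by omega) (by omega) _
      (hp.2 i hi) (hr.2 i hi)
  obtain ⟨a, g, hag⟩ := hconn.exists_eq_Ico_add ⟨n, fun v hv => hv.1.le⟩
  refine ⟨(i₀.val : ZMod n) + (a : ZMod n), g, Set.ext fun x => ?_⟩
  rw [hmem, Set.mem_ofPred_eq]
  constructor
  · intro hx
    have hv : (x - (i₀.val : ZMod n)).val ∈ S := by
      refine ⟨ZMod.val_lt _, fun i hi => ?_⟩
      convert hx i hi using 2
      rw [ZMod.natCast_zmod_val]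
      ring
    rw [hag] at hv
    refine ⟨(x - (i₀.val : ZMod n)).val - a, by have := hv.1; have := hv.2; omega, ?_⟩
    rw [Nat.cast_sub hv.1, ZMod.natCast_zmod_val]
    ring
  · rintro ⟨r, hr, rfl⟩ i hi
    have hv : a + r ∈ S := by
      rw [hag]
      exact ⟨by omega, by omega⟩
    convert hv.2 i hi using 2
    push_cast
    ring
end

section
/- Let n and k be integers with n > 2(k−1) and k ≥ 1, and for i ∈ {1,…,n} let L_i = {i−1, i, …, i−1+(n−k)} (mod n) ⊆ ℤ/nℤ. Then for every subset T ⊆ {1,…,n} with |T| = c and 1 ≤ c ≤ k, the complement (ℤ/nℤ) \ ⋃_{i∈T} L_i has at most k − c elements. -/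
open scoped Pointwise in
/-- If all differences `t - x` with `t ∈ T`, `x ∈ C` lie in `{1, …, k - 1}` modulo `n > 2 (k - 1)`,
then `#T + #C ≤ k`. -/
theorem ZMod.card_add_card_le_of_val_sub_mem {n k : ℕ} [NeZero n] (hn : 2 * (k - 1) < n)
    {T C : Finset (ZMod n)} (hT : T.Nonempty) (hC : C.Nonempty)
    (h : ∀ t ∈ T, ∀ x ∈ C, 1 ≤ (t - x).val ∧ (t - x).val < k) :
    T.card + C.card ≤ k := by
  obtain ⟨t₀, ht₀⟩ := hT
  obtain ⟨x₀, hx₀⟩ := hC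
  set E : Finset ℕ := T.image fun t => (t - x₀).val with hE
  set A : Finset ℕ := C.image fun x => (t₀ - x).val with hA
  have hEcard : E.card = T.card :=
    Finset.card_image_of_injective _ ((ZMod.val_injective n).comp (sub_left_injective))
  have hAcard : A.card = C.card :=
    Finset.card_image_of_injective _ ((ZMod.val_injective n).comp (sub_right_injective))
  have hEne : E.Nonempty := ⟨_, Finset.mem_image_of_mem _ ht₀⟩
  have hAne : A.Nonempty := ⟨_, Finset.mem_image_of_mem _ hx₀⟩
  have hsub : E + A ⊆ Finset.Ico (1 + (t₀ - x₀).val) (k + (t₀ - x₀).val) := by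
    intro y hy
    obtain ⟨e, he, a, ha, rfl⟩ := Finset.mem_add.1 hy
    obtain ⟨t, ht, rfl⟩ := Finset.mem_image.1 he
    obtain ⟨x, hx, rfl⟩ := Finset.mem_image.1 ha
    have h₁ := h t ht x hx
    have h₂ := h t ht x₀ hx₀
    have h₃ := h t₀ ht₀ x hx
    have h₄ := h t₀ ht₀ x₀ hx₀
    have hdvd : (n : ℤ) ∣ ((t - x₀).val + (t₀ - x).val - (t₀ - x₀).val - (t - x).val : ℤ) := by
      rw [← ZMod.intCast_zmod_eq_zero_iff_dvd]
      push_cast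
      simp only [ZMod.natCast_val, ZMod.cast_id', id_eq]
      ring
    have hzero := Int.eq_zero_of_abs_lt_dvd hdvd (by rw [abs_lt]; omega)
    rw [Finset.mem_Ico]
    omega
  have hle := Finset.card_le_card hsub
  have hcd := cauchy_davenport_add_of_linearOrder_isCancelAdd hEne hAne
  have hpos := h t₀ ht₀ x₀ hx₀
  rw [Nat.card_Ico] at hle
  omega

/-- For `n > 2(k-1)`, the complement of the union of `c` cyclic supports
`L_i` (with `1 ≤ c ≤ k`) has at most `k - c` elements. -/
theorem stmt_9 (n k c : ℕ) (hk : 1 ≤ k) (hn : 2 * (k - 1) < n)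
    (L : Fin n → Set (ZMod n))
    (hL : ∀ i : Fin n,
      L i = {x : ZMod n | ∃ r : ℕ, r ≤ n - k ∧ x = (i.val : ZMod n) + (r : ZMod n)})
    (T : Finset (Fin n)) (hcard : T.card = c) (hc : 1 ≤ c) (hck : c ≤ k) :
    (Set.univ \ ⋃ i ∈ T, L i).ncard ≤ k - c := by
  classical
  have : NeZero n := ⟨by omega⟩
  rw [Set.ncard_eq_toFinset_card']
  set C := (Set.univ \ ⋃ i ∈ T, L i).toFinset with hCdef
  rcases C.eq_empty_or_nonempty with hC | hC
  · simp [hC]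
  have hinj : Function.Injective fun i : Fin n => (i.val : ZMod n) := by
    intro i j hij
    have := congrArg ZMod.val hij
    simpa [ZMod.val_natCast, Nat.mod_eq_of_lt, Fin.ext_iff] using this
  have hTne : T.Nonempty := Finset.card_pos.1 (by omega)
  have hmain := ZMod.card_add_card_le_of_val_sub_mem (k := k) hn
    (T := T.image fun i : Fin n => (i.val : ZMod n)) (hTne.image _) hC (by
      intro t ht x hx
      obtain ⟨i, hi, rfl⟩ := Finset.mem_image.1 ht
      have hxL : x ∉ L i := fun hxi =>
        (Set.mem_toFinset.1 hx).2 (Set.mem_biUnion (Finset.mem_coe.2 hi) hxi)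
      have hr : n - k < (x - (i.val : ZMod n)).val := by
        by_contra! hle
        refine hxL ?_
        rw [hL]
        exact ⟨_, hle, by simp⟩
      have hlt := ZMod.val_lt (x - (i.val : ZMod n))
      have hne : x - (i.val : ZMod n) ≠ 0 := fun h0 => by simp [h0] at hr
      have hneg := ZMod.neg_val (x - (i.val : ZMod n))
      rw [if_neg hne, neg_sub] at hneg
      omega)
  rw [Finset.card_image_of_injective _ hinj] at hmain
  omega
end

section
/- Let n ≥ 1, k ≥ 1 and g ≥ 0 be integers with n ≥ 2(k−1) + g, and let t ∈ ℤ/nℤ. Then there exists a subset S ⊆ ℤ/nℤ with |S| = n − k + 1 such that {t, t+1, …, t+g−1} ⊆ S and S satisfies the consecutive coordinate property: for every r ∈ ℤ/nℤ, r ∈ S or r+1 ∈ S. -/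
theorem ZMod.natCast_inj_of_lt {n a b : ℕ} (ha : a < n) (hb : b < n)
    (h : (a : ZMod n) = b) : a = b := by
  rw [ZMod.natCast_eq_natCast_iff] at h
  exact h.eq_of_lt_of_lt ha hb

/-- If `n ≥ 2(k-1) + g` then there is a set `S ⊆ ℤ/nℤ` of size `n - k + 1`
containing the interval `{t, …, t+g-1}` and satisfying the consecutive coordinate
property. -/
theorem stmt_11 (n k g : ℕ) (hn : 1 ≤ n) (hk : 1 ≤ k) (hng : 2 * (k - 1) + g ≤ n)
    (t : ZMod n) :
    ∃ S : Set (ZMod n), S.ncard = n - k + 1 ∧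
      (∀ r : ℕ, r < g → t + (r : ZMod n) ∈ S) ∧
      (∀ x : ZMod n, x ∈ S ∨ x + 1 ∈ S) := by
  have : NeZero n := ⟨by omega⟩
  let C : Finset (ZMod n) :=
    (Finset.range (k - 1)).image fun i => t + ((g + 2 * i : ℕ) : ZMod n)
  have mem_C (x : ZMod n) : x ∈ C ↔ ∃ i < k - 1, t + ((g + 2 * i : ℕ) : ZMod n) = x := by
    simp only [C, Finset.mem_image, Finset.mem_range]
  have card_C : C.card = k - 1 := by
    rw [Finset.card_image_of_injOn, Finset.card_range]
    intro i hi j hj hij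
    have hi := Finset.mem_range.mp hi
    have hj := Finset.mem_range.mp hj
    have := ZMod.natCast_inj_of_lt (by omega) (by omega) (add_left_cancel hij)
    omega
  refine ⟨(↑C)ᶜ, ?_, fun r hr h => ?_, fun x => ?_⟩
  · rw [← Finset.coe_compl, Set.ncard_coe_finset, Finset.card_compl, ZMod.card, card_C]
    omega
  · obtain ⟨i, hi, h⟩ := (mem_C _).mp h
    have := ZMod.natCast_inj_of_lt (by omega) (by omega) (add_left_cancel h)
    omega
  · by_contra! h
    obtain ⟨i, hi, hx⟩ := (mem_C x).mp (not_not.mp h.1)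
    obtain ⟨j, hj, hy⟩ := (mem_C (x + 1)).mp (not_not.mp h.2)
    rw [← hx, add_assoc, ← Nat.cast_succ] at hy
    have := ZMod.natCast_inj_of_lt (by omega) (by omega) (add_left_cancel hy)
    omega
end

section
/- Let k ≥ 2, C ≥ 2 and 0 ≤ l ≤ k−2 be integers and set n₁ = (k−1)(C+1) + l. For i ∈ {1,…,C} define Z_i = {0,1,…,n₁−1} \ {(j−1)C + ((i−2) mod C) : j = 1,…,k−1}. Then: (a) |Z_i| = n₁ − k + 1 for every i; (b) {n₁−k+1, …, n₁−1} ⊆ Z_i for every i; (c) every Z_i satisfies the consecutive coordinate property, i.e., for every r ∈ ℤ/n₁ℤ, r ∈ Z_i or r+1 ∈ Z_i; and (d) Z_r ∪ Z_s = {0,1,…,n₁−1} for all distinct r, s ∈ {1,…,C}. -/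
theorem Nat.mul_add_lt_mul_of_lt {m C j a : ℕ} (hj : j < m) (ha : a < C) : j * C + a < m * C := by
  have h : (j + 1) * C ≤ m * C := Nat.mul_le_mul_right C hj
  linarith [add_one_mul j C]

theorem ZMod.natCast_inj_of_lt_s12 {n p q : ℕ} (hp : p < n) (hq : q < n)
    (h : (p : ZMod n) = (q : ZMod n)) : p = q := by
  rwa [ZMod.natCast_eq_natCast_iff', Nat.mod_eq_of_lt hp, Nat.mod_eq_of_lt hq] at h

theorem Fin.eq_of_pred_mod_eq {C : ℕ} {r s : Fin C}
    (h : (r.val + C - 1) % C = (s.val + C - 1) % C) : r = s := by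
  have hr := r.isLt
  have hs := s.isLt
  rw [Nat.add_sub_assoc (by omega), Nat.add_sub_assoc (by omega)] at h
  have hmod : r.val ≡ s.val [MOD C] := Nat.ModEq.add_right_cancel' (C - 1) h
  exact Fin.ext (Nat.ModEq.eq_of_lt_of_lt hmod hr hs)

/-- Properties of the supports `Z_i` of the rows of `B_M` in
Construction 2: with coordinates `0,…,n₁-1 ≅ ℤ/n₁ℤ` and `i, j` 0-indexed
(`i ∈ {1,…,C}` corresponds to `i.val = i-1`, `j ∈ {1,…,k-1}` to `j' = j-1 < k-1`),
`Z_i` is the complement of `{j'·C + ((i.val + C - 1) % C) : j' < k-1}`. -/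
theorem stmt_12 (k C l : ℕ) (hk : 2 ≤ k) (hC : 2 ≤ C) (hl : l ≤ k - 2)
    (n₁ : ℕ) (hn₁ : n₁ = (k - 1) * (C + 1) + l)
    (Z : Fin C → Set (ZMod n₁))
    (hZ : ∀ i : Fin C, Z i = Set.univ \
      {x : ZMod n₁ | ∃ j : ℕ, j < k - 1 ∧
        x = ((j * C + (i.val + C - 1) % C : ℕ) : ZMod n₁)}) :
    (∀ i : Fin C, (Z i).ncard = n₁ - k + 1) ∧
    (∀ i : Fin C, ∀ r : ℕ, n₁ - k + 1 ≤ r → r < n₁ → ((r : ℕ) : ZMod n₁) ∈ Z i) ∧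
    (∀ i : Fin C, ∀ x : ZMod n₁, x ∈ Z i ∨ x + 1 ∈ Z i) ∧
    (∀ r s : Fin C, r ≠ s → Z r ∪ Z s = Set.univ) := by
  obtain ⟨m, rfl⟩ : ∃ m, k = m + 1 := ⟨k - 1, by omega⟩
  simp only [Nat.add_sub_cancel] at hn₁ hZ
  have hn : n₁ = m * C + m + l := by rw [hn₁]; ring
  have hmC : 0 < m * C := Nat.mul_pos (by omega) (by omega)
  have hn_pos : 0 < n₁ := by omega
  have : NeZero n₁ := ⟨hn_pos.ne'⟩
  have hsub : n₁ - (m + 1) + 1 = n₁ - m := by omega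
  have hmod : ∀ i : Fin C, (i.val + C - 1) % C < C := fun i => Nat.mod_lt _ (by omega)
  have hlt : ∀ (i : Fin C) (j : ℕ), j < m → j * C + (i.val + C - 1) % C < m * C :=
    fun i j hj => Nat.mul_add_lt_mul_of_lt hj (hmod i)
  have hmem : ∀ (i : Fin C) (x : ZMod n₁), x ∉ Z i ↔
      ∃ j < m, x = ((j * C + (i.val + C - 1) % C : ℕ) : ZMod n₁) := by
    intro i x
    simp [hZ i]
  refine ⟨fun i => ?_, fun i r hr hrn => ?_, fun i x => ?_, fun r s hrs => ?_⟩
  · have hcompl : (Z i)ᶜ =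
        (fun j : ℕ => ((j * C + (i.val + C - 1) % C : ℕ) : ZMod n₁)) '' Set.Iio m := by
      ext x
      rw [Set.mem_compl_iff, hmem]
      simp only [Set.mem_image, Set.mem_Iio, eq_comm]
    have hcard : ((Z i)ᶜ).ncard = m := by
      rw [hcompl, Set.InjOn.ncard_image]
      · simp [Set.ncard_eq_toFinset_card']
      · intro j hj j' hj' h
        have h₁ := hlt i j hj
        have h₂ := hlt i j' hj'
        have h := ZMod.natCast_inj_of_lt_s12 (by omega) (by omega) h
        exact Nat.eq_of_mul_eq_mul_right (by omega) (Nat.add_right_cancel h)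
    have hadd := Set.ncard_add_ncard_compl (Z i)
    rw [Nat.card_zmod] at hadd
    omega
  · by_contra h
    obtain ⟨j, hj, h⟩ := (hmem _ _).1 h
    have h₁ := hlt i j hj
    have := ZMod.natCast_inj_of_lt_s12 hrn (by omega) h
    omega
  · by_contra! h
    obtain ⟨j, hj, hx⟩ := (hmem _ _).1 h.1
    obtain ⟨j', hj', hx'⟩ := (hmem _ _).1 h.2
    have h₁ := hlt i j hj
    have h₂ := hlt i j' hj'
    rw [hx, ← Nat.cast_add_one] at hx'
    have h := ZMod.natCast_inj_of_lt_s12 (by omega) (by omega) hx'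
    have hdvd : C ∣ 1 := (Nat.dvd_add_right (Dvd.intro_left j rfl)).1
      (Dvd.intro_left j' (by omega : j' * C = j * C + 1))
    have := Nat.le_of_dvd one_pos hdvd
    omega
  · refine Set.eq_univ_of_forall fun x => ?_
    by_contra h
    rw [Set.mem_union, not_or] at h
    obtain ⟨j, hj, hx⟩ := (hmem _ _).1 h.1
    obtain ⟨j', hj', hx'⟩ := (hmem _ _).1 h.2
    have h₁ := hlt r j hj
    have h₂ := hlt s j' hj'
    have h := congrArg (· % C) (ZMod.natCast_inj_of_lt_s12 (by omega) (by omega) (hx.symm.trans hx'))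
    simp only [Nat.mul_add_mod_self_right, Nat.mod_mod] at h
    exact hrs (Fin.eq_of_pred_mod_eq h)
end

section
/- Let k ≥ 2, C ≥ 2 and 0 ≤ l ≤ k−2 be integers, set n₁ = (k−1)(C+1) + l, and index coordinates by {0,…,n₁−1} ≅ ℤ/n₁ℤ. For i ∈ {1,…,n₁} let L_i = {i−1, i, …, i−1+(n₁−k)} (mod n₁), and for i ∈ {1,…,C} let Z_i = {0,…,n₁−1} \ {(j−1)C + ((i−2) mod C) : j = 1,…,k−1}. Then for every I₁ ⊆ {2,…,n₁} and I₂ ⊆ {1,…,C} with |I₁| + |I₂| = k − 1, and every T₁ ⊆ {1} ∪ I₁ and T₂ ⊆ I₂ with |T₁| + |T₂| = ℓ ≥ 1, the union ⋃_{i∈T₁} L_i ∪ ⋃_{j∈T₂} Z_j has at least (n₁ − k) + ℓ elements. -/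
/-- If every `i ∈ T` lies in the cyclic window `{x + 1, …, x + m}` of every `x ∈ Y`, then `Y` lies
in a cyclic window of length `m + 1 - #T`. -/
theorem ZMod.exists_window {n m : ℕ} (hmn : 2 * m ≤ n) {T : Finset (ZMod n)} (hT : T.Nonempty)
    {Y : Set (ZMod n)} (hYne : Y.Nonempty)
    (hY : ∀ x ∈ Y, ∀ i ∈ T, ∃ u : ℕ, 1 ≤ u ∧ u ≤ m ∧ i = x + u) :
    ∃ p : ZMod n, ∀ x ∈ Y, ∃ a : ℕ, 1 ≤ a ∧ a + T.card ≤ m + 1 ∧ x = p - a := by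
  obtain ⟨x₀, hx₀⟩ := hYne
  choose! u hu1 hum hu using hY x₀ hx₀
  obtain ⟨i, hi, himin⟩ := T.exists_min_image u hT
  obtain ⟨j, hj, hjmax⟩ := T.exists_max_image u hT
  have hcard : T.card ≤ (Finset.Icc (u i) (u j)).card := by
    refine Finset.card_le_card_of_injOn u
      (fun a ha => Finset.mem_coe.2 (Finset.mem_Icc.2 ⟨himin a ha, hjmax a ha⟩)) ?_
    intro a ha b hb hab
    rw [hu a ha, hu b hb, hab]
  rw [Nat.card_Icc] at hcard
  refine ⟨i, fun x hx => ?_⟩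
  obtain ⟨a, ha1, ham, ha⟩ := hY x hx i hi
  obtain ⟨b, hb1, hbm, hb⟩ := hY x hx j hj
  refine ⟨a, ha1, ?_, by rw [ha]; ring⟩
  have hi1 := hu1 i hi
  have hj1 := hum j hj
  have hij := himin j hj
  have key : ((a + u j - 1 : ℕ) : ZMod n) = (b + u i - 1 : ℕ) := by
    rw [Nat.cast_sub (by omega), Nat.cast_sub (by omega)]
    push_cast
    have e1 := hu i hi
    have e2 := hu j hj
    linear_combination hb - ha + e1 - e2
  have := ZMod.natCast_inj_of_lt (by omega) (by omega) key
  omega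

theorem ZMod.exists_add_eq_of_notMem_interval {n m : ℕ} [NeZero n] (hm : m < n) (i x : ZMod n)
    (hx : ¬ ∃ r : ℕ, r ≤ n - (m + 1) ∧ x = i + r) :
    ∃ u : ℕ, 1 ≤ u ∧ u ≤ m ∧ i = x + u := by
  have hlt := ZMod.val_lt (x - i)
  have hval : ((x - i).val : ZMod n) = x - i := ZMod.natCast_zmod_val _
  have hr : ¬ (x - i).val ≤ n - (m + 1) := fun h => hx ⟨_, h, by rw [hval]; ring⟩
  refine ⟨n - (x - i).val, by omega, by omega, ?_⟩
  rw [Nat.cast_sub hlt.le, hval, ZMod.natCast_self]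
  ring

theorem Set.ncard_le_of_forall_eq_sub {n q : ℕ} {p : ZMod n} {Y : Set (ZMod n)}
    (hY : ∀ x ∈ Y, ∃ a : ℕ, 1 ≤ a ∧ a ≤ q ∧ x = p - a) : Y.ncard ≤ q := by
  have hsub : Y ⊆ ((Finset.Icc 1 q).image fun a : ℕ => p - (a : ZMod n) : Finset (ZMod n)) := by
    intro x hx
    obtain ⟨a, h1, h2, rfl⟩ := hY x hx
    exact Finset.mem_coe.2 (Finset.mem_image.2 ⟨a, Finset.mem_Icc.2 ⟨h1, h2⟩, rfl⟩)
  calc Y.ncard ≤ _ := Set.ncard_le_ncard hsub (Finset.finite_toSet _)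
    _ ≤ q := by
      rw [Set.ncard_coe_finset]
      exact Finset.card_image_le.trans (by simp)

/-- A set inside a cyclic window of length `q + 1 ≥ 2` that contains no two consecutive residues
has at most `q` elements. -/
theorem Set.ncard_le_of_no_consecutive {n q : ℕ} (hq : 1 ≤ q) {p : ZMod n} {Y : Set (ZMod n)}
    (hY : ∀ x ∈ Y, ∃ a : ℕ, 1 ≤ a ∧ a ≤ q + 1 ∧ x = p - a)
    (hcons : ∀ x ∈ Y, x + 1 ∉ Y) : Y.ncard ≤ q := by
  obtain ⟨c, hc, hcY⟩ : ∃ c ∈ Finset.Icc 1 (q + 1), p - ((c : ℕ) : ZMod n) ∉ Y := by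
    by_cases h : p - ((2 : ℕ) : ZMod n) ∈ Y
    · refine ⟨1, Finset.mem_Icc.2 ⟨le_rfl, by omega⟩, fun h1 => hcons _ h ?_⟩
      convert h1 using 1
      push_cast
      ring
    · exact ⟨2, Finset.mem_Icc.2 ⟨by omega, by omega⟩, h⟩
  have hsub : Y ⊆ (((Finset.Icc 1 (q + 1)).erase c).image
      fun a : ℕ => p - (a : ZMod n) : Finset (ZMod n)) := by
    intro x hx
    obtain ⟨a, h1, h2, rfl⟩ := hY x hx
    refine Finset.mem_coe.2 (Finset.mem_image.2 ⟨a, Finset.mem_erase.2 ⟨?_,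
      Finset.mem_Icc.2 ⟨h1, h2⟩⟩, rfl⟩)
    rintro rfl
    exact hcY hx
  calc Y.ncard ≤ _ := Set.ncard_le_ncard hsub (Finset.finite_toSet _)
    _ ≤ q := by
      rw [Set.ncard_coe_finset]
      refine Finset.card_image_le.trans ?_
      rw [Finset.card_erase_of_mem hc]
      simp

theorem Nat.mul_add_lt_mul {m C j s : ℕ} (hj : j < m) (hs : s < C) : j * C + s < m * C := by
  have : (j + 1) * C ≤ m * C := Nat.mul_le_mul_right C hj
  rw [add_mul] at this
  omega

theorem Nat.eq_of_add_sub_one_mod_eq {C i j : ℕ} (hi : i < C) (hj : j < C)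
    (h : (i + C - 1) % C = (j + C - 1) % C) : i = j := by
  have shift : ∀ a, a < C → (a + C - 1) % C = if a = 0 then C - 1 else a - 1 := by
    intro a ha
    split_ifs with h0
    · subst h0
      rw [zero_add, Nat.mod_eq_of_lt (by omega)]
    · rw [show a + C - 1 = a - 1 + C by omega, Nat.add_mod_right, Nat.mod_eq_of_lt (by omega)]
  rw [shift i hi, shift j hj] at h
  split_ifs at h <;> omega


/-- The support condition for Construction 2 of the
`(n₁, n₂ = n₁ + C, k, c = 1)` tiered gradient code with `M = {server 1}`:
rows of `F` are 0-indexed (`i₀` is server 1), `L` are the cyclic supports and `Z`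
the supports of the rows of `B_M`. -/
theorem stmt_13 (k C l : ℕ) (hk : 2 ≤ k) (hC : 2 ≤ C) (hl : l ≤ k - 2)
    (n₁ : ℕ) (hn₁ : n₁ = (k - 1) * (C + 1) + l)
    (L : Fin n₁ → Set (ZMod n₁))
    (hL : ∀ i : Fin n₁,
      L i = {x : ZMod n₁ | ∃ r : ℕ, r ≤ n₁ - k ∧ x = (i.val : ZMod n₁) + (r : ZMod n₁)})
    (Z : Fin C → Set (ZMod n₁))
    (hZ : ∀ i : Fin C, Z i = Set.univ \
      {x : ZMod n₁ | ∃ j : ℕ, j < k - 1 ∧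
        x = ((j * C + (i.val + C - 1) % C : ℕ) : ZMod n₁)})
    (i₀ : Fin n₁) (hi₀ : i₀.val = 0) :
    ∀ I₁ : Finset (Fin n₁), i₀ ∉ I₁ →
      ∀ I₂ : Finset (Fin C), I₁.card + I₂.card = k - 1 →
        ∀ T₁ : Finset (Fin n₁), T₁ ⊆ insert i₀ I₁ →
          ∀ T₂ : Finset (Fin C), T₂ ⊆ I₂ →
            ∀ ℓ : ℕ, T₁.card + T₂.card = ℓ → 1 ≤ ℓ →
              (n₁ - k) + ℓ ≤ ((⋃ i ∈ T₁, L i) ∪ ⋃ j ∈ T₂, Z j).ncard := by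
  obtain ⟨m, rfl⟩ : ∃ m, k = m + 1 := ⟨k - 1, by omega⟩
  simp only [Nat.add_sub_cancel] at *
  have hn : n₁ = m * C + m + l := by rw [hn₁]; ring
  have hmC : 2 * m ≤ m * C := by rw [mul_comm]; exact Nat.mul_le_mul_left m hC
  have : NeZero n₁ := ⟨by omega⟩
  intro I₁ hI₁ I₂ hI T₁ hT₁ T₂ hT₂ ℓ hℓ hℓ1
  have hcT₁ : T₁.card ≤ I₁.card + 1 :=
    (Finset.card_le_card hT₁).trans (Finset.card_insert_le _ _)
  have hcT₂ : T₂.card ≤ I₂.card := Finset.card_le_card hT₂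
  set U : Set (ZMod n₁) := (⋃ i ∈ T₁, L i) ∪ ⋃ j ∈ T₂, Z j with hU
  have hcompl : U.ncard + Uᶜ.ncard = n₁ := by
    rw [Set.ncard_add_ncard_compl, Nat.card_zmod]
  have hYL : ∀ x ∈ Uᶜ, ∀ i ∈ T₁, ∃ u : ℕ, 1 ≤ u ∧ u ≤ m ∧ ((i.val : ℕ) : ZMod n₁) = x + u := by
    intro x hx i hi
    refine ZMod.exists_add_eq_of_notMem_interval (by omega) _ _ fun h => hx (Or.inl ?_)
    exact Set.mem_biUnion hi (by rw [hL]; exact h)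
  have hYZ : ∀ x ∈ Uᶜ, ∀ i ∈ T₂, ∃ j : ℕ, j < m ∧
      x = ((j * C + (i.val + C - 1) % C : ℕ) : ZMod n₁) := by
    intro x hx i hi
    by_contra h
    exact hx (Or.inr (Set.mem_biUnion hi (by rw [hZ]; exact ⟨trivial, h⟩)))
  have hmod : ∀ i : Fin C, (i.val + C - 1) % C < C := fun i => Nat.mod_lt _ (by omega)
  suffices Uᶜ.ncard + ℓ ≤ m + 1 by omega
  rcases Set.eq_empty_or_nonempty Uᶜ with hY | hY
  · rw [hY, Set.ncard_empty]
    omega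
  have hT₂1 : T₂.card ≤ 1 := by
    obtain ⟨x, hx⟩ := hY
    refine Finset.card_le_one.2 fun a ha b hb => ?_
    obtain ⟨j, hj, hja⟩ := hYZ x hx a ha
    obtain ⟨j', hj', hjb⟩ := hYZ x hx b hb
    have h1 := Nat.mul_add_lt_mul hj (hmod a)
    have h2 := Nat.mul_add_lt_mul hj' (hmod b)
    have h := ZMod.natCast_inj_of_lt (by omega) (by omega) (hja.symm.trans hjb)
    have h' := congrArg (· % C) h
    simp only [Nat.mul_add_mod_self_right, Nat.mod_mod] at h'
    exact Fin.ext (Nat.eq_of_add_sub_one_mod_eq a.2 b.2 h')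
  rcases T₁.eq_empty_or_nonempty with h1 | h1
  · subst h1
    obtain ⟨i, hi⟩ : T₂.Nonempty := Finset.card_pos.1 (by simp at hℓ; omega)
    have hsub : Uᶜ ⊆ ((Finset.range m).image
        fun j : ℕ => ((j * C + (i.val + C - 1) % C : ℕ) : ZMod n₁) : Finset (ZMod n₁)) := by
      intro x hx
      obtain ⟨j, hj, rfl⟩ := hYZ x hx i hi
      exact Finset.mem_coe.2 (Finset.mem_image.2 ⟨j, Finset.mem_range.2 hj, rfl⟩)
    have hle := Set.ncard_le_ncard hsub (Finset.finite_toSet _)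
    rw [Set.ncard_coe_finset] at hle
    have := hle.trans Finset.card_image_le
    rw [Finset.card_range] at this
    simp only [Finset.card_empty] at hℓ
    omega
  have hcard : (T₁.image fun i : Fin n₁ => ((i.val : ℕ) : ZMod n₁)).card = T₁.card :=
    Finset.card_image_of_injective _ fun a b h => Fin.ext (ZMod.natCast_inj_of_lt a.2 b.2 h)
  obtain ⟨p, hp⟩ := ZMod.exists_window (m := m) (by omega)
    (h1.image fun i : Fin n₁ => ((i.val : ℕ) : ZMod n₁)) hY
    (fun x hx i hi => by
      obtain ⟨i', hi', rfl⟩ := Finset.mem_image.1 hi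
      exact hYL x hx i' hi')
  rw [hcard] at hp
  have hT₁m : T₁.card ≤ m := by
    obtain ⟨x, hx⟩ := hY
    obtain ⟨a, ha, hb, -⟩ := hp x hx
    omega
  rcases T₂.eq_empty_or_nonempty with h2 | ⟨i, hi⟩
  · subst h2
    have := Set.ncard_le_of_forall_eq_sub (q := m + 1 - T₁.card) fun x hx => by
      obtain ⟨a, ha, hb, hab⟩ := hp x hx
      exact ⟨a, ha, by omega, hab⟩
    simp only [Finset.card_empty] at hℓ
    omega
  have hT₂c : 1 ≤ T₂.card := Finset.card_pos.2 ⟨i, hi⟩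
  rcases hT₁m.lt_or_eq with hlt | heq
  · have := Set.ncard_le_of_no_consecutive (q := m - T₁.card) (by omega) (Y := Uᶜ) (p := p)
      (fun x hx => by
        obtain ⟨a, ha, hb, hab⟩ := hp x hx
        exact ⟨a, ha, by omega, hab⟩)
      (fun x hx hx1 => by
        obtain ⟨j, hj, hjx⟩ := hYZ x hx i hi
        obtain ⟨j', hj', hjx'⟩ := hYZ _ hx1 i hi
        have hb := Nat.mul_add_lt_mul hj (hmod i)
        have hb' := Nat.mul_add_lt_mul hj' (hmod i)
        have h := ZMod.natCast_inj_of_lt (n := n₁) (a := j * C + (i.val + C - 1) % C + 1)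
          (b := j' * C + (i.val + C - 1) % C) (by omega) (by omega) (by rw [← hjx', hjx]; push_cast; ring)
        have h' : j * C + 1 = j' * C := by omega
        have : C ∣ 1 := (Nat.dvd_add_right (Dvd.intro_left j rfl)).1 (h' ▸ Dvd.intro_left j' rfl)
        exact absurd (Nat.le_of_dvd one_pos this) (by omega))
    omega
  · have hT₁eq : T₁ = insert i₀ I₁ := Finset.eq_of_subset_of_card_le hT₁ (by
      rw [Finset.card_insert_of_notMem hI₁]
      omega)
    obtain ⟨x, hx⟩ := hY
    obtain ⟨u, hu1, hum, hu⟩ := hYL x hx i₀ (by rw [hT₁eq]; exact Finset.mem_insert_self _ _)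
    obtain ⟨j, hj, hjx⟩ := hYZ x hx i hi
    have hb := Nat.mul_add_lt_mul hj (hmod i)
    have h := ZMod.natCast_inj_of_lt (n := n₁) (a := 0) (b := j * C + (i.val + C - 1) % C + u)
      (by omega) (by omega) (by rw [hi₀] at hu; rw [hu, hjx]; push_cast; ring)
    omega
end

section
/- Let k ≥ 2, n₁ ≥ 3(k−1) and n₁ < n₂ ≤ n₁ + ⌊(n₁−k+1)/(k−1)⌋. Then there exists an (n₁, n₂, k, c = 1) tiered gradient code with Q = n₁ data partitions in which every row of F and every row of each B_M has support of size at most n₁ − k + 1; hence its computation per server is (n₁−k+1)/n₁, which is strictly less than the fraction (n₂−k+1)/n₂ required by the (n₂, k) gradient code. -/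
open Finset

/-- The forward cyclic distance from `i` to `x` on `n` points. -/
def cycDist {n : ℕ} (i x : Fin n) : ℕ :=
  if (i : ℕ) ≤ x then (x : ℕ) - i else (x : ℕ) + n - i

/-- The point at forward cyclic distance `v` from `i`. -/
def cycShift {n : ℕ} (i : Fin n) (v : ℕ) : Fin n :=
  ⟨((i : ℕ) + v) % n, Nat.mod_lt _ (Nat.zero_lt_of_lt i.isLt)⟩

theorem cycDist_cycShift {n : ℕ} (i : Fin n) {v : ℕ} (hv : v < n) :
    cycDist i (cycShift i v) = v := by
  have hi := i.isLt
  unfold cycDist cycShift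
  by_cases h : (i : ℕ) + v < n
  · simp [Nat.mod_eq_of_lt h]
  · have h' : ((i : ℕ) + v) % n = i + v - n := by
      rw [Nat.mod_eq_sub_mod (by omega), Nat.mod_eq_of_lt (by omega)]
    simp only [h']
    split_ifs <;> omega

theorem cycDist_left_injective {n : ℕ} (i : Fin n) : Function.Injective (cycDist i) := by
  intro x y h
  have := x.isLt
  have := y.isLt
  have := i.isLt
  unfold cycDist at h
  ext
  split_ifs at h <;> omega

/-- If the points of `T` lie within distance `t` after every point of `A`, then `T` spans a window
of some length `D` (bounding `T`), which leaves at most `t - D` choices for the points of `A`. -/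
theorem exists_window {n t : ℕ} (hn : 2 * t ≤ n) (A T : Finset (Fin n)) (hA : A.Nonempty)
    (hT : T.Nonempty) (h : ∀ i ∈ A, ∀ x ∈ T, cycDist i x < t) :
    ∃ D, #A + D ≤ t ∧ #T ≤ D + 1 ∧
      ((∀ a : Fin n, ∀ x ∈ T, ∀ y ∈ T, cycDist a x ≠ cycDist a y + 1) → #T ≤ D / 2 + 1) := by
  obtain ⟨a, ha⟩ := hA
  obtain ⟨p, hp, hpmin⟩ := T.exists_min_image (cycDist a) hT
  obtain ⟨r, hr, hrmax⟩ := T.exists_max_image (cycDist a) hT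
  have hpr := hpmin r hr
  have hrt := h a ha r hr
  refine ⟨cycDist a r - cycDist a p, ?_, ?_, ?_⟩
  · have : #A ≤ #(range (t - (cycDist a r - cycDist a p))) := by
      refine card_le_card_of_injOn (fun i => cycDist i p) ?_ ?_
      · intro i hi
        have h1 := h i hi p hp
        have h2 := h i hi r hr
        have h3 := h a ha p hp
        simp only [coe_range, Set.mem_Iio]
        have := i.isLt
        have := a.isLt
        have := p.isLt
        have := r.isLt
        unfold cycDist at *
        split_ifs at * <;> omega
      · intro i _ j _ hij
        have := i.isLt
        have := j.isLt
        have := p.isLt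
        simp only [cycDist] at hij
        ext
        split_ifs at hij <;> omega
    rw [card_range] at this
    omega
  · have : #T ≤ #(range (cycDist a r - cycDist a p + 1)) := by
      refine card_le_card_of_injOn (fun x => cycDist a x - cycDist a p) ?_ ?_
      · intro x hx
        have := hpmin x hx
        have := hrmax x hx
        simp only [coe_range, Set.mem_Iio]
        omega
      · intro x hx y hy hxy
        have := hpmin x hx
        have := hpmin y hy
        simp only at hxy
        exact cycDist_left_injective a (by omega)
    simpa using this
  · intro hsep
    have : #T ≤ #(range ((cycDist a r - cycDist a p) / 2 + 1)) := by
      refine card_le_card_of_injOn (fun x => (cycDist a x - cycDist a p) / 2) ?_ ?_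
      · intro x hx
        have := hpmin x hx
        have := hrmax x hx
        simp only [coe_range, Set.mem_Iio]
        omega
      · intro x hx y hy hxy
        have := hpmin x hx
        have := hpmin y hy
        have := hsep a x hx y hy
        have := hsep a y hy x hx
        simp only at hxy
        exact cycDist_left_injective a (by omega)
    simpa using this

/-- Zero positions of the rows available around the mandatory row `c`: cyclic intervals for the
rows of `F`, spread-out sets avoiding the interval at `c` for the additional rows. -/
def zeroPos {n : ℕ} (t m : ℕ) (c : Fin n) : Fin n ⊕ Fin m → Fin t → Fin n
  | .inl i, s => cycShift i s
  | .inr j, s => cycShift c (t + j + s * max m 2)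

theorem spread_lt {n t m : ℕ} (hn : 3 * t ≤ n) (hm : m * t ≤ n - t) (j : Fin m) (s : Fin t) :
    t + j + s * max m 2 < n := by
  have hj := j.isLt
  have hs := s.isLt
  have h1 : ((s : ℕ) + 1) * max m 2 ≤ t * max m 2 := Nat.mul_le_mul_right _ hs
  have h2 : t * max m 2 ≤ n - t := by
    rcases max_cases m 2 with ⟨h, _⟩ | ⟨h, _⟩ <;> rw [h]
    · rwa [mul_comm]
    · omega
  have h3 : m ≤ max m 2 := le_max_left _ _
  rw [add_mul] at h1
  omega

theorem zeroPos_injective {n t m : ℕ} (hn : 3 * t ≤ n) (hm : m * t ≤ n - t) (c : Fin n)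
    (l : Fin n ⊕ Fin m) : Function.Injective (zeroPos t m c l) := by
  intro s s' h
  have hs := s.isLt
  have hs' := s'.isLt
  rcases l with i | j
  · have := congrArg (cycDist i) h
    simp only [zeroPos] at this
    rw [cycDist_cycShift i (by omega), cycDist_cycShift i (by omega)] at this
    exact Fin.ext this
  · have := congrArg (cycDist c) h
    simp only [zeroPos] at this
    rw [cycDist_cycShift c (spread_lt hn hm j s), cycDist_cycShift c (spread_lt hn hm j s')] at this
    have h' : (s : ℕ) * max m 2 = s' * max m 2 := by omega
    exact Fin.ext (Nat.eq_of_mul_eq_mul_right (by positivity) h')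

theorem cycDist_lt_of_mem_inl {n t m : ℕ} (hn : 3 * t ≤ n) {c i x : Fin n}
    (hx : x ∈ Set.range (zeroPos t m c (.inl i))) : cycDist i x < t := by
  obtain ⟨s, rfl⟩ := hx
  have hs := s.isLt
  simp only [zeroPos]
  rw [cycDist_cycShift i (by omega)]
  exact hs

theorem cycDist_eq_of_mem_inr {n t m : ℕ} (hn : 3 * t ≤ n) (hm : m * t ≤ n - t) {c x : Fin n}
    {j : Fin m} (hx : x ∈ Set.range (zeroPos t m c (.inr j))) :
    ∃ s, s < t ∧ cycDist c x = t + j + s * max m 2 := by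
  obtain ⟨s, rfl⟩ := hx
  exact ⟨s, s.isLt, cycDist_cycShift c (spread_lt hn hm j s)⟩

theorem inr_unique {n t m : ℕ} (hn : 3 * t ≤ n) (hm : m * t ≤ n - t) {c x : Fin n}
    {j j' : Fin m} (hx : x ∈ Set.range (zeroPos t m c (.inr j)))
    (hx' : x ∈ Set.range (zeroPos t m c (.inr j'))) : j = j' := by
  obtain ⟨s, _, h⟩ := cycDist_eq_of_mem_inr hn hm hx
  obtain ⟨s', _, h'⟩ := cycDist_eq_of_mem_inr hn hm hx'
  have hj : (j : ℕ) < max m 2 := j.isLt.trans_le (le_max_left _ _)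
  have hj' : (j' : ℕ) < max m 2 := j'.isLt.trans_le (le_max_left _ _)
  have e : (j : ℕ) + s * max m 2 = j' + s' * max m 2 := by omega
  have := congrArg (· % max m 2) e
  simp only [Nat.add_mul_mod_self_right, Nat.mod_eq_of_lt hj, Nat.mod_eq_of_lt hj'] at this
  exact Fin.ext this

theorem inr_separated {n t m : ℕ} (hn : 3 * t ≤ n) (hm : m * t ≤ n - t) {c x y : Fin n}
    {j : Fin m} (hx : x ∈ Set.range (zeroPos t m c (.inr j)))
    (hy : y ∈ Set.range (zeroPos t m c (.inr j))) (a : Fin n) :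
    cycDist a x ≠ cycDist a y + 1 := by
  intro hxy
  obtain ⟨s, hs, h⟩ := cycDist_eq_of_mem_inr hn hm hx
  obtain ⟨s', _, h'⟩ := cycDist_eq_of_mem_inr hn hm hy
  have e : cycDist c x = cycDist c y + 1 := by
    have : 0 < cycDist c x := by omega
    have := a.isLt
    have := c.isLt
    have := x.isLt
    have := y.isLt
    clear h h'
    unfold cycDist at *
    split_ifs at * <;> omega
  have h2 : 2 ≤ max m 2 := le_max_right _ _
  have e' : s * max m 2 = s' * max m 2 + 1 := by omega
  have := congrArg (· % max m 2) e'
  simp only [Nat.mul_mod_left, Nat.mul_add_mod_self_right] at this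
  rw [Nat.mod_eq_of_lt (by omega)] at this
  omega

/-- A bound on the number of rows vanishing on a set `T`. -/
theorem card_rows_vanishing_le {n t m : ℕ} (hn : 3 * t ≤ n) (hm : m * t ≤ n - t) (c : Fin n)
    (L : Finset (Fin n ⊕ Fin m)) (hL : #L = t + 1) (hc : .inl c ∈ L) (T : Finset (Fin n))
    (hT : T.Nonempty) (hTt : #T ≤ t) (C : Finset (Fin n ⊕ Fin m)) (hCL : C ⊆ L)
    (hC : ∀ l ∈ C, ∀ x ∈ T, x ∈ Set.range (zeroPos t m c l)) : #C + #T ≤ t + 1 := by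
  have hcard : #C = #C.toLeft + #C.toRight := (card_toLeft_add_card_toRight).symm
  have hA : ∀ i ∈ C.toLeft, ∀ x ∈ T, cycDist i x < t := fun i hi x hx =>
    cycDist_lt_of_mem_inl hn (hC _ (mem_toLeft.1 hi) x hx)
  have hT1 : 0 < #T := hT.card_pos
  obtain ⟨x, hx⟩ := hT
  have hJ : #C.toRight ≤ 1 := card_le_one.2 fun j hj j' hj' =>
    inr_unique hn hm (hC _ (mem_toRight.1 hj) x hx) (hC _ (mem_toRight.1 hj') x hx)
  rcases C.toLeft.eq_empty_or_nonempty with hA0 | hAne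
  · rw [hA0, card_empty] at hcard
    omega
  obtain ⟨D, h1, h2, h3⟩ := exists_window (by omega) _ T hAne ⟨x, hx⟩ hA
  rcases C.toRight.eq_empty_or_nonempty with hJ0 | ⟨j, hj⟩
  · rw [hJ0, card_empty] at hcard
    omega
  have hj' := mem_toRight.1 hj
  have h4 := h3 fun a y hy z hz => inr_separated hn hm (hC _ hj' y hy) (hC _ hj' z hz) a
  by_cases hT2 : 2 ≤ #T
  · omega
  · have hcC : .inl c ∉ C := by
      intro hcC
      have := cycDist_lt_of_mem_inl hn (hC _ hcC x hx)
      obtain ⟨s, _, hs⟩ := cycDist_eq_of_mem_inr hn hm (hC _ hj' x hx)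
      omega
    have : #C < #L := card_lt_card ⟨hCL, fun h => hcC (h hc)⟩
    omega

/-- A family of zero patterns such that the positions of each pattern can be matched to distinct
rows which are allowed to be nonzero there. -/
def IsMatchable {n t : ℕ} (Z : Fin (t + 1) → Fin t → Fin n) : Prop :=
  ∀ a, Function.Injective (Z a) ∧
    ∃ φ : Fin t → Fin (t + 1), Function.Injective φ ∧ ∀ s, Z a s ∉ Set.range (Z (φ s))

theorem isMatchable_zeroPos {n t m : ℕ} (hn : 3 * t ≤ n) (hm : m * t ≤ n - t) (c : Fin n)
    (l : Fin (t + 1) → Fin n ⊕ Fin m) (hl : Function.Injective l) (hc : ∃ a, l a = .inl c) :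
    IsMatchable fun a => zeroPos t m c (l a) := by
  classical
  intro a
  have hinj := zeroPos_injective hn hm c (l a)
  refine ⟨hinj, ?_⟩
  obtain ⟨φ, hφ, hφ'⟩ := (all_card_le_biUnion_card_iff_exists_injective
    (fun s : Fin t => {b | zeroPos t m c (l a) s ∉ Set.range (zeroPos t m c (l b))})).1 (by
      intro S
      rcases S.eq_empty_or_nonempty with rfl | hS
      · simp
      set U := S.biUnion fun s : Fin t =>
        ({b | zeroPos t m c (l a) s ∉ Set.range (zeroPos t m c (l b))} : Finset (Fin (t + 1)))
        with hU
      have hSt : #S ≤ t := by simpa using card_le_univ S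
      have key := card_rows_vanishing_le hn hm c (univ.image l)
        (by rw [card_image_of_injective _ hl]; simp)
        (by obtain ⟨b, hb⟩ := hc; exact mem_image.2 ⟨b, mem_univ _, hb⟩)
        (S.image (zeroPos t m c (l a))) (hS.image _)
        (by rwa [card_image_of_injective _ hinj]) (Uᶜ.image l)
        (image_subset_image (subset_univ _))
        (by
          intro r hr x hx
          obtain ⟨b, hb, rfl⟩ := mem_image.1 hr
          obtain ⟨s, hs, rfl⟩ := mem_image.1 hx
          by_contra hcon
          exact mem_compl.1 hb (mem_biUnion.2 ⟨s, hs, by simpa using hcon⟩))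
      rw [card_image_of_injective _ hinj, card_image_of_injective _ hl, card_compl,
        Fintype.card_fin] at key
      have : #U ≤ t + 1 := by simpa using card_le_univ U
      omega)
  exact ⟨φ, hφ, fun s => by simpa using hφ' s⟩

/-- The generalized cross product of the `t` vectors `G (z s)` in `R ^ (t + 1)`. -/
def crossVec {R : Type*} [CommRing R] {n t : ℕ} (G : Fin n → Fin (t + 1) → R)
    (z : Fin t → Fin n) (i : Fin (t + 1)) : R :=
  (-1) ^ (i : ℕ) * (Matrix.of fun s j => G (z s) (i.succAbove j)).det

theorem sum_mul_crossVec {R : Type*} [CommRing R] {n t : ℕ} (G : Fin n → Fin (t + 1) → R)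
    (z : Fin t → Fin n) (v : Fin (t + 1) → R) :
    ∑ i, v i * crossVec G z i =
      (Matrix.of (Fin.cons v fun s => G (z s) : Fin (t + 1) → Fin (t + 1) → R)).det := by
  rw [Matrix.det_succ_row_zero]
  refine sum_congr rfl fun i _ => ?_
  simp only [crossVec, Matrix.of_apply, Fin.cons_zero]
  rw [mul_left_comm, mul_assoc]
  rfl

theorem sum_mul_crossVec_self {R : Type*} [CommRing R] {n t : ℕ} (G : Fin n → Fin (t + 1) → R)
    (z : Fin t → Fin n) (s : Fin t) : ∑ i, G (z s) i * crossVec G z i = 0 := by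
  rw [sum_mul_crossVec]
  exact Matrix.det_zero_of_row_eq (Fin.succ_ne_zero s).symm (by ext; simp)

theorem crossVec_eq_det {R : Type*} [CommRing R] {n t : ℕ} (G : Fin n → Fin (t + 1) → R)
    (z : Fin t → Fin n) (i : Fin (t + 1)) :
    crossVec G z i = (Matrix.of
      (Fin.cons (Pi.single i 1) fun s => G (z s) : Fin (t + 1) → Fin (t + 1) → R)).det := by
  rw [← sum_mul_crossVec]
  simp [Pi.single_apply]

theorem map_crossVec {R S : Type*} [CommRing R] [CommRing S] (f : R →+* S) {n t : ℕ}
    (G : Fin n → Fin (t + 1) → R) (z : Fin t → Fin n) (i : Fin (t + 1)) :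
    f (crossVec G z i) = crossVec (fun q j => f (G q j)) z i := by
  simp only [crossVec, map_mul, map_pow, map_neg, map_one, RingHom.map_det]
  rfl

theorem map_det_crossVec {R S : Type*} [CommRing R] [CommRing S] (f : R →+* S) {n t : ℕ}
    (G : Fin n → Fin (t + 1) → R) (Z : Fin (t + 1) → Fin t → Fin n) :
    f (Matrix.of fun a => crossVec G (Z a)).det =
      (Matrix.of fun a => crossVec (fun q j => f (G q j)) (Z a)).det := by
  rw [RingHom.map_det]
  congr 1
  ext a i
  exact map_crossVec f G (Z a) i

/-- The cross product of distinct unit vectors `e_(φ s)` is nonzero at the remaining coordinate. -/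
theorem crossVec_matching_ne_zero {n t : ℕ} (z : Fin t → Fin n)
    (φ : Fin t → Fin (t + 1)) (hφ : Function.Injective φ) (a : Fin (t + 1))
    (ha : ∀ s, φ s ≠ a) (G : Fin n → Fin (t + 1) → ℝ)
    (hG : ∀ s, G (z s) = Pi.single (φ s) 1) : crossVec G z a ≠ 0 := by
  have hinj : Function.Injective (Fin.cons a φ : Fin (t + 1) → Fin (t + 1)) :=
    Fin.cons_injective_iff.2 ⟨by rintro ⟨s, hs⟩; exact ha s hs, hφ⟩
  let σ : Equiv.Perm (Fin (t + 1)) :=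
    Equiv.ofBijective _ (Finite.injective_iff_bijective.1 hinj)
  have : (Matrix.of (Fin.cons (Pi.single a 1) fun s => G (z s) :
      Fin (t + 1) → Fin (t + 1) → ℝ)) = (1 : Matrix _ _ ℝ).submatrix σ id := by
    ext i j
    refine Fin.cases ?_ (fun s => ?_) i
    · simp [σ, Matrix.one_apply, Pi.single_apply, eq_comm]
    · simp [σ, hG, Matrix.one_apply, Pi.single_apply, eq_comm]
  rw [crossVec_eq_det, this, Matrix.det_permute]
  simp

theorem det_crossVec_X_ne_zero {n t : ℕ} (Z : Fin (t + 1) → Fin t → Fin n)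
    (hZ : IsMatchable Z) :
    (Matrix.of fun a => crossVec
      (fun q j => (MvPolynomial.X (q, j) : MvPolynomial (Fin n × Fin (t + 1)) ℝ)) (Z a)).det
      ≠ 0 := by
  classical
  let mask : Fin n → Fin (t + 1) → MvPolynomial (Fin n × Fin (t + 1)) ℝ := fun q j =>
    if q ∈ Set.range (Z j) then 0 else MvPolynomial.X (q, j)
  let f : MvPolynomial (Fin n × Fin (t + 1)) ℝ →+* MvPolynomial (Fin n × Fin (t + 1)) ℝ :=
    (MvPolynomial.aeval (R := ℝ) fun p : Fin n × Fin (t + 1) => mask p.1 p.2).toRingHom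
  intro h0
  have h1 := congrArg f h0
  rw [map_det_crossVec, map_zero] at h1
  have hf : (fun q j => f (MvPolynomial.X (q, j))) = mask := by
    funext q j
    simp [f]
  rw [hf] at h1
  have hdiag : (Matrix.of fun a => crossVec mask (Z a)) =
      Matrix.diagonal fun a => crossVec mask (Z a) a := by
    ext1 a i
    by_cases hai : a = i
    · subst hai; simp
    · rw [Matrix.diagonal_apply_ne _ hai, Matrix.of_apply, crossVec_eq_det]
      refine Matrix.det_eq_zero_of_column_eq_zero a fun r => ?_
      refine Fin.cases ?_ (fun s => ?_) r
      · simp [hai]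
      · simp [mask]
  rw [hdiag, Matrix.det_diagonal, prod_eq_zero_iff] at h1
  obtain ⟨a, -, ha⟩ := h1
  obtain ⟨hinj, φ, hφ, hφZ⟩ := hZ a
  let pt : Fin n × Fin (t + 1) → ℝ := fun p => if ∃ s, Z a s = p.1 ∧ φ s = p.2 then 1 else 0
  have h2 := congrArg (MvPolynomial.eval pt) ha
  rw [map_crossVec, map_zero] at h2
  refine crossVec_matching_ne_zero (Z a) φ hφ a ?_ _ ?_ h2
  · rintro s rfl
    exact hφZ s ⟨s, rfl⟩
  · intro s
    funext j
    by_cases hj : j = φ s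
    · subst hj
      have : ¬ ∃ y, Z (φ s) y = Z a s := hφZ s
      simp only [mask, Set.mem_range, if_neg this, MvPolynomial.eval_X, Pi.single_eq_same, pt]
      exact if_pos ⟨s, rfl, rfl⟩
    · rw [Pi.single_eq_of_ne hj]
      simp only [mask]
      split_ifs
      · simp
      · rw [MvPolynomial.eval_X]
        refine if_neg ?_
        rintro ⟨s', h, h'⟩
        exact hj (h'.symm.trans (congrArg φ (hinj h)))

/-- A generic point configuration: no vector is orthogonal to the all-ones vector, and the cross
products of every matchable family are linearly independent. -/
theorem exists_generic (n t : ℕ) : ∃ G : Fin n → Fin (t + 1) → ℝ, (∀ q, ∑ i, G q i ≠ 0) ∧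
    ∀ Z, IsMatchable Z → (Matrix.of fun a => crossVec G (Z a)).det ≠ 0 := by
  classical
  let X : Fin n → Fin (t + 1) → MvPolynomial (Fin n × Fin (t + 1)) ℝ :=
    fun q j => MvPolynomial.X (q, j)
  let P := (∏ q, ∑ i, X q i) *
    ∏ Z with IsMatchable Z, (Matrix.of fun a => crossVec X (Z a)).det
  have hP : P ≠ 0 := by
    refine mul_ne_zero (prod_ne_zero_iff.2 fun q _ h => ?_)
      (prod_ne_zero_iff.2 fun Z hZ => det_crossVec_X_ne_zero Z (by simpa using hZ))
    have := congrArg (MvPolynomial.eval fun _ => (1 : ℝ)) h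
    simp only [X, map_sum, MvPolynomial.eval_X, map_zero, sum_const, card_univ, Fintype.card_fin,
      nsmul_eq_mul, mul_one] at this
    exact absurd this (by positivity)
  obtain ⟨g, hg⟩ : ∃ g, MvPolynomial.eval g P ≠ 0 := by
    by_contra! h
    exact hP (MvPolynomial.funext fun g => by rw [h g, map_zero])
  rw [map_mul, map_prod, map_prod] at hg
  have hX : (fun q j => MvPolynomial.eval g (X q j)) = fun q j => g (q, j) := by
    funext q j
    exact MvPolynomial.eval_X _
  refine ⟨fun q j => g (q, j), fun q => ?_, fun Z hZ => ?_⟩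
  · have := prod_ne_zero_iff.1 (left_ne_zero_of_mul hg) q (mem_univ q)
    simpa [X] using this
  · have := prod_ne_zero_iff.1 (right_ne_zero_of_mul hg) Z (by simpa using hZ)
    rwa [map_det_crossVec, hX] at this

/-- The row with zeros at the positions `z` in the code generated by `G`, normalized so that the
all-ones vector of coefficients yields the all-ones row. -/
noncomputable def codeRow {n t : ℕ} (G : Fin n → Fin (t + 1) → ℝ) (z : Fin t → Fin n)
    (q : Fin n) : ℝ :=
  (∑ i, G q i * crossVec G z i) / ∑ i, G q i

theorem card_support_codeRow_le {n t : ℕ} (G : Fin n → Fin (t + 1) → ℝ) (z : Fin t → Fin n)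
    (hz : Function.Injective z) : #{q | codeRow G z q ≠ 0} ≤ n - t := by
  have h : ({q | codeRow G z q ≠ 0} : Finset (Fin n)) ⊆ (univ.map ⟨z, hz⟩)ᶜ := by
    intro q hq
    simp only [mem_compl, mem_map, mem_univ, true_and, Function.Embedding.coeFn_mk]
    rintro ⟨s, rfl⟩
    simp [codeRow, sum_mul_crossVec_self] at hq
  simpa [card_compl] using card_le_card h

theorem one_mem_span_codeRow {n t : ℕ} (G : Fin n → Fin (t + 1) → ℝ)
    (hG : ∀ q, ∑ i, G q i ≠ 0) (Z : Fin (t + 1) → Fin t → Fin n)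
    (hZ : (Matrix.of fun a => crossVec G (Z a)).det ≠ 0) :
    (fun _ => (1 : ℝ)) ∈ Submodule.span ℝ (Set.range fun a => codeRow G (Z a)) := by
  set U := Matrix.of fun a => crossVec G (Z a) with hU
  let w : Fin (t + 1) → ℝ := Matrix.vecMul (fun _ => 1) U⁻¹
  have hw : Matrix.vecMul w U = fun _ => 1 := by
    simp only [w, Matrix.vecMul_vecMul]
    rw [Matrix.nonsing_inv_mul _ (isUnit_iff_ne_zero.2 hZ), Matrix.vecMul_one]
  have : (fun _ => (1 : ℝ)) = ∑ a, w a • codeRow G (Z a) := by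
    funext q
    simp only [Finset.sum_apply, Pi.smul_apply, smul_eq_mul, codeRow, mul_div_assoc']
    rw [← sum_div, eq_div_iff (hG q), one_mul]
    simp only [mul_sum]
    rw [sum_comm]
    refine sum_congr rfl fun i _ => ?_
    have := congrFun hw i
    simp only [Matrix.vecMul, dotProduct, hU, Matrix.of_apply] at this
    calc G q i = G q i * ∑ a, w a * crossVec G (Z a) i := by rw [this, mul_one]
      _ = _ := by rw [mul_sum]; exact sum_congr rfl fun a _ => by ring
  rw [this]
  exact Submodule.sum_mem _ fun a _ =>
    Submodule.smul_mem _ _ (Submodule.subset_span ⟨a, rfl⟩)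


/-- For `k ≥ 2`, `n₁ ≥ 3(k-1)` and `n₁ < n₂ ≤ n₁ + ⌊(n₁-k+1)/(k-1)⌋`,
there is an `(n₁, n₂, k, c = 1)` tiered gradient code with `Q = n₁` partitions whose
rows all have support of size at most `n₁ - k + 1`; its computation per server
`(n₁-k+1)/n₁` is strictly smaller than `(n₂-k+1)/n₂`. -/
theorem stmt_14 (k n₁ n₂ : ℕ) (hk : 2 ≤ k) (hn₁ : 3 * (k - 1) ≤ n₁)
    (h1 : n₁ < n₂) (h2 : n₂ ≤ n₁ + (n₁ - k + 1) / (k - 1)) :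
    ∃ (F : Matrix (Fin n₁) (Fin n₁) ℝ)
      (B : Finset (Fin n₁) → Matrix (Fin (n₂ - n₁)) (Fin n₁) ℝ),
      (∀ M : Finset (Fin n₁), M.card = 1 →
        ∀ I₁ : Finset (Fin n₁), Disjoint I₁ M →
          ∀ I₂ : Finset (Fin (n₂ - n₁)), I₁.card + I₂.card = k - 1 →
            (fun _ => (1 : ℝ)) ∈ Submodule.span ℝ
              ({v : Fin n₁ → ℝ | ∃ i ∈ M ∪ I₁, v = F i} ∪
               {v : Fin n₁ → ℝ | ∃ j ∈ I₂, v = B M j})) ∧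
      (∀ i : Fin n₁, (Finset.univ.filter fun q => F i q ≠ 0).card ≤ n₁ - k + 1) ∧
      (∀ M : Finset (Fin n₁), M.card = 1 → ∀ j : Fin (n₂ - n₁),
        (Finset.univ.filter fun q => B M j q ≠ 0).card ≤ n₁ - k + 1) ∧
      ((n₁ : ℝ) - (k : ℝ) + 1) / (n₁ : ℝ) < ((n₂ : ℝ) - (k : ℝ) + 1) / (n₂ : ℝ) := by
  obtain ⟨t, rfl⟩ : ∃ t, k = t + 1 := ⟨k - 1, by omega⟩
  rw [Nat.add_sub_cancel] at hn₁ h2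
  have ht : 0 < t := by omega
  have hs : n₁ - (t + 1) + 1 = n₁ - t := by omega
  rw [hs] at h2 ⊢
  have hm : (n₂ - n₁) * t ≤ n₁ - t := (Nat.le_div_iff_mul_le ht).1 (by omega)
  obtain ⟨G, hG, hgen⟩ := exists_generic n₁ t
  refine ⟨fun i => codeRow G fun s => cycShift i s,
    fun M j => ∑ c ∈ M, codeRow G (zeroPos t (n₂ - n₁) c (.inr j)), ?_, ?_, ?_, ?_⟩
  · intro M hM I₁ hI₁ I₂ hcard
    obtain ⟨c, rfl⟩ := Finset.card_eq_one.1 hM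
    let L : Finset (Fin n₁ ⊕ Fin (n₂ - n₁)) := (insert c I₁).disjSum I₂
    have hL : L.card = t + 1 := by
      rw [Finset.card_disjSum, Finset.card_insert_of_notMem (Finset.disjoint_singleton_right.1 hI₁)]
      omega
    let l : Fin (t + 1) → Fin n₁ ⊕ Fin (n₂ - n₁) := fun a => (L.equivFinOfCardEq hL).symm a
    have hl : Function.Injective l :=
      Subtype.val_injective.comp (L.equivFinOfCardEq hL).symm.injective
    have hc : ∃ a, l a = .inl c :=
      ⟨L.equivFinOfCardEq hL ⟨.inl c, by simp [L]⟩, by simp [l]⟩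
    refine Submodule.span_mono ?_ (one_mem_span_codeRow G hG _
      (hgen _ (isMatchable_zeroPos hn₁ hm c l hl hc)))
    rintro _ ⟨a, rfl⟩
    have ha : l a ∈ L := ((L.equivFinOfCardEq hL).symm a).2
    rcases hla : l a with i | j
    · rw [hla] at ha
      exact Or.inl ⟨i, by simpa [L] using ha, by simp only [hla]; rfl⟩
    · rw [hla] at ha
      exact Or.inr ⟨j, by simpa [L] using ha, by simp [hla]⟩
  · intro i
    exact card_support_codeRow_le G _ (zeroPos_injective hn₁ hm i (.inl i))
  · intro M hM j
    obtain ⟨c, rfl⟩ := Finset.card_eq_one.1 hM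
    simpa using card_support_codeRow_le G _ (zeroPos_injective hn₁ hm c (.inr j))
  · have h0 : (0 : ℝ) < n₁ := by exact_mod_cast (by omega : 0 < n₁)
    have h3 : (n₁ : ℝ) < n₂ := by exact_mod_cast h1
    have h4 : (0 : ℝ) < t := by exact_mod_cast ht
    rw [div_lt_div_iff₀ h0 (h0.trans h3)]
    push_cast
    nlinarith
end

section
/- Let k ≥ 2 be an even integer and set Q = k²/2, with coordinates indexed by ℤ/Qℤ. For i ∈ {1,…,k} let U_i = {((i−1)k/2 + r) mod Q : 0 ≤ r ≤ k−2}, and for m ∈ {1,…,k} let Z^{(m)} = {((j−1)k/2 + (k−1)) mod Q : j ∈ {0,1,…,k−1}, j ≠ m−1}. Then: (i) ⋃_{i=1}^{k} U_i = ℤ/Qℤ; (ii) |Z^{(m)}| = k−1 for every m; and (iii) for all distinct m, b ∈ {1,…,k}, (⋃_{i ∈ {1,…,k}\{b}} U_i) ∪ Z^{(m)} = ℤ/Qℤ. -/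
/-- Every residue modulo `k * h` is `q * h + r` for a block index `q < k` and an offset `r < h`. -/
theorem ZMod.exists_eq_mul_add {k h : ℕ} (hk : 0 < k) (hh : 0 < h) (x : ZMod (k * h)) :
    ∃ q < k, ∃ r < h, x = ((q * h + r : ℕ) : ZMod (k * h)) := by
  have : NeZero (k * h) := ⟨(Nat.mul_pos hk hh).ne'⟩
  refine ⟨x.val / h, (Nat.div_lt_iff_lt_mul hh).2 x.val_lt, x.val % h, Nat.mod_lt _ hh, ?_⟩
  rw [Nat.div_add_mod', ZMod.natCast_zmod_val]

/-- The residues `q * h + r` modulo `k * h` with a fixed offset `r < h` are distinct for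
distinct block indices `q < k`. -/
theorem ZMod.injOn_mul_add {k h r : ℕ} (hr : r < h) :
    Set.InjOn (fun q : ℕ => ((q * h + r : ℕ) : ZMod (k * h))) {q | q < k} := by
  have lt_of_lt : ∀ q < k, q * h + r < k * h := fun q hq => by
    have := Nat.mul_le_mul_right h (Nat.succ_le_of_lt hq)
    rw [Nat.succ_mul] at this
    omega
  intro a ha b hb hab
  have h_eq := (ZMod.natCast_eq_natCast_iff' _ _ _).1 hab
  rw [Nat.mod_eq_of_lt (lt_of_lt a ha), Nat.mod_eq_of_lt (lt_of_lt b hb)] at h_eq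
  exact Nat.eq_of_mul_eq_mul_right (by omega) (Nat.add_right_cancel h_eq)

/-- Modulo `k * h`, every block is reached from the preceding one, cyclically, by a shift by `h`. -/
theorem ZMod.exists_pred_block {k h b : ℕ} (hk : 2 ≤ k) (hb : b < k) (r : ℕ) :
    ∃ i < k, i ≠ b ∧
      ((b * h + r : ℕ) : ZMod (k * h)) = ((i * h + (h + r) : ℕ) : ZMod (k * h)) := by
  rcases Nat.eq_zero_or_pos b with rfl | hpos
  · refine ⟨k - 1, by omega, by omega, ?_⟩
    have : (k - 1) * h + (h + r) = k * h + (0 * h + r) := by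
      obtain ⟨c, rfl⟩ : ∃ c, k = c + 1 := ⟨k - 1, by omega⟩
      simp only [Nat.add_sub_cancel]
      ring
    rw [this, Nat.cast_add (k * h), ZMod.natCast_self, zero_add]
  · refine ⟨b - 1, by omega, by omega, ?_⟩
    obtain ⟨c, rfl⟩ : ∃ c, b = c + 1 := ⟨b - 1, by omega⟩
    congr 1
    simp only [Nat.add_sub_cancel]
    ring

/-- Combinatorial covering facts for Construction 3 (`n₁ = k`,
`n₂ = k+1`, `c = 1`, `k` even, `Q = k²/2`): servers are 0-indexed, so server
`i ∈ {1,…,k}` corresponds to `i.val = i - 1` and `U_i = {i.val·(k/2) + r : 0 ≤ r ≤ k-2}`,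
while `Z^{(m)} = {((j-1)·(k/2) + (k-1)) mod Q : 0 ≤ j < k, j ≠ m.val}`. -/
theorem stmt_15 (k : ℕ) (hk : 2 ≤ k) (hke : k % 2 = 0)
    (U : Fin k → Set (ZMod (k ^ 2 / 2)))
    (hU : ∀ i : Fin k, U i = {x : ZMod (k ^ 2 / 2) | ∃ r : ℕ, r ≤ k - 2 ∧
      x = ((i.val * (k / 2) + r : ℕ) : ZMod (k ^ 2 / 2))})
    (Z : Fin k → Set (ZMod (k ^ 2 / 2)))
    (hZ : ∀ m : Fin k, Z m = {x : ZMod (k ^ 2 / 2) | ∃ j : ℕ, j < k ∧ j ≠ m.val ∧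
      x = ((j : ZMod (k ^ 2 / 2)) - 1) * ((k / 2 : ℕ) : ZMod (k ^ 2 / 2)) +
        ((k - 1 : ℕ) : ZMod (k ^ 2 / 2))}) :
    (⋃ i, U i) = Set.univ ∧
    (∀ m : Fin k, (Z m).ncard = k - 1) ∧
    (∀ m b : Fin k, m ≠ b →
      (⋃ i ∈ ({b}ᶜ : Set (Fin k)), U i) ∪ Z m = Set.univ) := by
  obtain ⟨h, rfl⟩ : ∃ h, k = 2 * h := ⟨k / 2, by omega⟩
  have hh : 0 < h := by omega
  have h_half : 2 * h / 2 = h := by omega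
  have hQ : (2 * h) ^ 2 / 2 = 2 * h * h := by
    rw [show (2 * h) ^ 2 = 2 * (2 * h * h) by ring]
    exact Nat.mul_div_cancel_left _ two_pos
  rw [h_half] at hU hZ
  generalize (2 * h) ^ 2 / 2 = Q at *
  subst hQ
  have z_point : ∀ j : ℕ, ((j : ZMod (2 * h * h)) - 1) * (h : ZMod (2 * h * h)) +
      ((2 * h - 1 : ℕ) : ZMod (2 * h * h)) = ((j * h + (h - 1) : ℕ) : ZMod (2 * h * h)) := by
    intro j
    rw [show 2 * h - 1 = h + (h - 1) by omega]
    push_cast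
    ring
  simp only [z_point] at hZ
  refine ⟨?_, fun m => ?_, fun m b hmb => ?_⟩
  · refine Set.eq_univ_of_forall fun x => ?_
    obtain ⟨q, hq, r, hr, rfl⟩ := ZMod.exists_eq_mul_add (by omega) hh x
    refine Set.mem_iUnion.2 ⟨⟨q, hq⟩, ?_⟩
    rw [hU]
    exact ⟨r, by omega, rfl⟩
  · have z_image : Z m = (fun j : ℕ => ((j * h + (h - 1) : ℕ) : ZMod (2 * h * h))) ''
        ((Finset.range (2 * h)).erase m.val : Finset ℕ) := by
      rw [hZ]
      ext x
      simp only [Set.mem_ofPred_eq, Set.mem_image, Finset.mem_coe, Finset.mem_erase,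
        Finset.mem_range]
      constructor
      · rintro ⟨j, hj, hjm, rfl⟩
        exact ⟨j, ⟨hjm, hj⟩, rfl⟩
      · rintro ⟨j, ⟨hjm, hj⟩, rfl⟩
        exact ⟨j, hj, hjm, rfl⟩
    rw [z_image, Set.InjOn.ncard_image, Set.ncard_coe_finset,
      Finset.card_erase_of_mem (Finset.mem_range.2 m.isLt), Finset.card_range]
    exact (ZMod.injOn_mul_add (by omega)).mono fun j hj =>
      Finset.mem_range.1 (Finset.mem_of_mem_erase (Finset.mem_coe.1 hj))
  · refine Set.eq_univ_of_forall fun x => ?_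
    obtain ⟨q, hq, r, hr, rfl⟩ := ZMod.exists_eq_mul_add (by omega) hh x
    have mem_of_U : ∀ i : Fin (2 * h), i ≠ b → ∀ y ∈ U i,
        y ∈ (⋃ i ∈ ({b}ᶜ : Set (Fin (2 * h))), U i) ∪ Z m := fun i hi y hy =>
      Or.inl (Set.mem_biUnion (show i ∈ ({b}ᶜ : Set (Fin (2 * h))) from hi) hy)
    by_cases hqb : q = b.val
    · by_cases hr' : r = h - 1
      · right
        rw [hZ]
        exact ⟨q, hq, fun hqm => hmb (Fin.ext (hqm.symm.trans hqb)), by rw [hr']⟩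
      · obtain ⟨i, hi, hiq, h_eq⟩ := ZMod.exists_pred_block (h := h) hk hq r
        refine mem_of_U ⟨i, hi⟩ (fun hib => hiq ((congrArg Fin.val hib).trans hqb.symm)) _ ?_
        rw [hU]
        exact ⟨h + r, by omega, h_eq⟩
    · refine mem_of_U ⟨q, hq⟩ (fun hib => hqb (congrArg Fin.val hib)) _ ?_
      rw [hU]
      exact ⟨r, by omega, rfl⟩
end

section
/- Let k ≥ 2 and 1 ≤ c < k be integers, let n₁ ≥ 2(k−1) + (k−c), and let n₂ satisfy n₁ < n₂ ≤ n₁ + ⌊(n₁ − k + c)/(k−1)⌋. Then there exists an (n₁, n₂, k, c) tiered gradient code with Q = n₁ data partitions in which every row of F and every row of each B_M has support of size at most n₁ − k + 1; hence its computation per server is (n₁−k+1)/n₁, which is strictly less than the fraction (n₂−k+1)/n₂ required by the (n₂, k) gradient code. -/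
/-- The vector of signed maximal minors of `m` vectors in `R ^ (m + 1)`. -/
def signedMinors {R : Type*} [CommRing R] {m : ℕ} (v : Fin m → Fin (m + 1) → R)
    (a : Fin (m + 1)) : R :=
  (-1) ^ (a : ℕ) * ((Matrix.of v).submatrix id a.succAbove).det

theorem sum_signedMinors_mul_eq_zero {R : Type*} [CommRing R] {m : ℕ}
    (v : Fin m → Fin (m + 1) → R) (l : Fin m) : ∑ a, signedMinors v a * v l a = 0 := by
  have h : (Matrix.of (Fin.cons (v l) v : Fin (m + 1) → Fin (m + 1) → R)).det = 0 :=
    Matrix.det_zero_of_row_eq (Fin.succ_ne_zero l).symm (by ext; simp)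
  rw [Matrix.det_succ_row_zero] at h
  rw [← h]
  refine Finset.sum_congr rfl fun a _ => ?_
  have : (Matrix.of (Fin.cons (v l) v : Fin (m + 1) → Fin (m + 1) → R)).submatrix
      Fin.succ a.succAbove = (Matrix.of v).submatrix id a.succAbove := by
    ext; simp
  rw [this, signedMinors]
  simp only [Matrix.of_apply, Fin.cons_zero]
  ring

theorem map_signedMinors {R S : Type*} [CommRing R] [CommRing S] (φ : R →+* S) {m : ℕ}
    (v : Fin m → Fin (m + 1) → R) (a : Fin (m + 1)) :
    φ (signedMinors v a) = signedMinors (fun l b => φ (v l b)) a := by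
  simp only [signedMinors, map_mul, map_pow, map_neg, map_one, RingHom.map_det]
  rfl

theorem MvPolynomial.exists_forall_eval_ne_zero {σ τ R : Type*} [CommRing R] [IsDomain R]
    [Infinite R] [Finite τ] (P : τ → MvPolynomial σ R) (hP : ∀ t, P t ≠ 0) :
    ∃ x : σ → R, ∀ t, MvPolynomial.eval x (P t) ≠ 0 := by
  have := Fintype.ofFinite τ
  have h : ∏ t, P t ≠ 0 := Finset.prod_ne_zero_iff.2 fun t _ => hP t
  obtain ⟨x, hx⟩ : ∃ x, MvPolynomial.eval x (∏ t, P t) ≠ 0 := by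
    by_contra! hx
    exact h (MvPolynomial.funext fun x => by simpa using hx x)
  refine ⟨x, fun t ht => hx ?_⟩
  rw [map_prod]
  exact Finset.prod_eq_zero (Finset.mem_univ t) ht

/-- Hall's condition for the non-zero pattern of the minor omitting row `i`. -/
theorem exists_perm_forall_notMem {κ : Type*} [Fintype κ] [DecidableEq κ] {m : ℕ}
    (Z : Fin (m + 1) → Finset κ) (i : Fin (m + 1)) (z : Fin m → κ)
    (hinj : Function.Injective z) (hz : ∀ l, z l ∈ Z i)
    (hall : ∀ T : Finset (Fin (m + 1)), T.Nonempty →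
      (Finset.univ.filter fun q => ∀ j ∈ T, q ∈ Z j).card + T.card ≤ m + 1) :
    ∃ σ : Equiv.Perm (Fin m), ∀ j, z (σ j) ∉ Z (i.succAbove j) := by
  classical
  have key : ∀ s : Finset (Fin m), s.card ≤
      (s.biUnion fun j => Finset.univ.filter fun l => z l ∉ Z (i.succAbove j)).card := by
    intro s
    have h1 := hall (insert i (s.map i.succAboveEmb)) (Finset.insert_nonempty _ _)
    rw [Finset.card_insert_of_notMem (by simp), Finset.card_map] at h1
    have h2 : (Finset.univ.filter fun l => ∀ j ∈ s, z l ∈ Z (i.succAbove j)).card ≤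
        (Finset.univ.filter fun q => ∀ j ∈ insert i (s.map i.succAboveEmb), q ∈ Z j).card := by
      refine Finset.card_le_card_of_injOn z (fun l hl => ?_) hinj.injOn
      simpa [hz] using hl
    have h3 : (s.biUnion fun j => Finset.univ.filter fun l => z l ∉ Z (i.succAbove j)) =
        Finset.univ.filter fun l => ¬ ∀ j ∈ s, z l ∈ Z (i.succAbove j) := by
      ext l; simp
    have h4 := Finset.card_filter_add_card_filter_not (s := (Finset.univ : Finset (Fin m)))
      (fun l => ∀ j ∈ s, z l ∈ Z (i.succAbove j))
    rw [Finset.card_univ, Fintype.card_fin] at h4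
    rw [h3]
    omega
  obtain ⟨f, hf, hfz⟩ := (Finset.all_card_le_biUnion_card_iff_exists_injective _).1 key
  exact ⟨Equiv.ofBijective f hf.bijective_of_finite, fun j => by simpa using hfz j⟩

theorem exists_det_signedMinors_ne_zero {κ : Type*} [Fintype κ] [DecidableEq κ] {m : ℕ}
    (Z : Fin (m + 1) → Finset κ) (z : Fin (m + 1) → Fin m → κ)
    (hinj : ∀ i, Function.Injective (z i)) (hz : ∀ i l, z i l ∈ Z i)
    (hall : ∀ T : Finset (Fin (m + 1)), T.Nonempty →
      (Finset.univ.filter fun q => ∀ j ∈ T, q ∈ Z j).card + T.card ≤ m + 1) :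
    ∃ G : Fin (m + 1) × κ → ℝ,
      (Matrix.of fun i => signedMinors fun l b => G (b, z i l)).det ≠ 0 := by
  classical
  let N : Fin (m + 1) × κ → MvPolynomial (Fin (m + 1) × κ) ℝ := fun p =>
    if p.2 ∈ Z p.1 then 0 else MvPolynomial.X p
  have hN : ∀ i, signedMinors (fun l b => N (b, z i l)) i ≠ 0 := by
    intro i h0
    obtain ⟨σ, hσ⟩ := exists_perm_forall_notMem Z i (z i) (hinj i) (hz i) hall
    let x : Fin (m + 1) × κ → ℝ := fun p =>
      if ∃ j, p = (i.succAbove j, z i (σ j)) then 1 else 0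
    have h1 := congrArg (MvPolynomial.eval x) h0
    rw [map_signedMinors, map_zero, signedMinors] at h1
    have h2 : ((Matrix.of fun l b => MvPolynomial.eval x (N (b, z i l))).submatrix id
        i.succAbove) = (1 : Matrix (Fin m) (Fin m) ℝ).submatrix id σ := by
      ext l j
      simp only [Matrix.submatrix_apply, Matrix.of_apply, id, Matrix.one_apply, N, x]
      by_cases hl : l = σ j
      · subst hl
        simp [hσ]
      · rw [if_neg hl]
        split_ifs with hmem
        · simp
        · rw [MvPolynomial.eval_X, if_neg]
          rintro ⟨j', hj'⟩
          simp only [Prod.mk.injEq, Fin.succAbove_right_inj] at hj'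
          obtain ⟨rfl, h⟩ := hj'
          exact hl (hinj i h)
    rw [h2, Matrix.det_permute'] at h1
    rcases Int.units_eq_one_or (Equiv.Perm.sign σ) with h | h <;> simp [h] at h1
  obtain ⟨x, hx⟩ := MvPolynomial.exists_forall_eval_ne_zero _ hN
  refine ⟨fun p => MvPolynomial.eval x (N p), ?_⟩
  have hdiag : (Matrix.of fun i => signedMinors fun l b => MvPolynomial.eval x (N (b, z i l))) =
      Matrix.diagonal fun i =>
        signedMinors (fun l b => MvPolynomial.eval x (N (b, z i l))) i := by
    ext i a
    rw [Matrix.diagonal_apply, Matrix.of_apply]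
    split_ifs with h
    · rw [h]
    · obtain ⟨j, hj⟩ := Fin.exists_succAbove_eq h
      rw [signedMinors, Matrix.det_eq_zero_of_column_eq_zero j, mul_zero]
      intro l
      simp [hj, N, hz]
  rw [hdiag, Matrix.det_diagonal]
  exact Finset.prod_ne_zero_iff.2 fun i _ => by simpa only [map_signedMinors] using hx i

/-- A generic `(m + 1)`-dimensional code containing the all-ones vector: every family of
`m + 1` codewords with prescribed zero sets of size `m` satisfying the Hall-type condition
spans the all-ones vector. -/
theorem exists_rows_one_mem_span {ι κ : Type*} [Fintype ι] [Fintype κ] [DecidableEq κ] {m : ℕ}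
    (Z : ι → Finset κ) (hZ : ∀ i, (Z i).card = m) :
    ∃ f : ι → κ → ℝ, (∀ i, ∀ q ∈ Z i, f i q = 0) ∧
      ∀ S : Finset ι, S.card = m + 1 →
        (∀ T ⊆ S, T.Nonempty →
          (Finset.univ.filter fun q => ∀ i ∈ T, q ∈ Z i).card + T.card ≤ m + 1) →
        (fun _ => (1 : ℝ)) ∈ Submodule.span ℝ (f '' S) := by
  classical
  let z : ι → Fin m → κ := fun i l => ((Z i).equivFinOfCardEq (hZ i)).symm l
  have hinj : ∀ i, Function.Injective (z i) := fun i =>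
    Subtype.val_injective.comp (Equiv.injective _)
  have hz : ∀ i l, z i l ∈ Z i := fun i l => Subtype.prop _
  have hsurj : ∀ i, ∀ q ∈ Z i, ∃ l, z i l = q := fun i q hq =>
    ⟨(Z i).equivFinOfCardEq (hZ i) ⟨q, hq⟩, by simp [z]⟩
  let D : (Fin (m + 1) → ι) → MvPolynomial (Fin (m + 1) × κ) ℝ := fun s =>
    (Matrix.of fun i => signedMinors fun l b => MvPolynomial.X (b, z (s i) l)).det
  have hD : ∀ (G : Fin (m + 1) × κ → ℝ) s, MvPolynomial.eval G (D s) =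
      (Matrix.of fun i => signedMinors fun l b => G (b, z (s i) l)).det := by
    intro G s
    rw [RingHom.map_det]
    congr 1
    ext i a
    simp [map_signedMinors]
  let P : {s // D s ≠ 0} ⊕ κ → MvPolynomial (Fin (m + 1) × κ) ℝ :=
    Sum.elim (fun s => D s) fun q => MvPolynomial.X (0, q)
  obtain ⟨G, hG⟩ := MvPolynomial.exists_forall_eval_ne_zero P (by
    rintro (s | q)
    · exact s.2
    · exact MvPolynomial.X_ne_zero _)
  have hG0 : ∀ q, G (0, q) ≠ 0 := fun q => by simpa [P] using hG (Sum.inr q)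
  let L : (Fin (m + 1) → ℝ) →ₗ[ℝ] κ → ℝ :=
    { toFun := fun w q => (∑ a, w a * G (a, q)) / G (0, q)
      map_add' := fun w w' => by
        ext q
        simp [add_mul, Finset.sum_add_distrib, add_div]
      map_smul' := fun r w => by
        ext q
        simp [mul_assoc, ← Finset.mul_sum, mul_div_assoc] }
  let x : ι → Fin (m + 1) → ℝ := fun i => signedMinors fun l b => G (b, z i l)
  refine ⟨fun i => L (x i), fun i q hq => ?_, fun S hS hall => ?_⟩
  · obtain ⟨l, rfl⟩ := hsurj i q hq
    change (∑ a, x i a * G (a, z i l)) / _ = 0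
    rw [sum_signedMinors_mul_eq_zero (fun l b => G (b, z i l)) l, zero_div]
  · let e := (S.equivFinOfCardEq hS).symm
    let s : Fin (m + 1) → ι := fun t => e t
    have hs : Function.Injective s := Subtype.val_injective.comp e.injective
    obtain ⟨G', hG'⟩ := exists_det_signedMinors_ne_zero (fun t => Z (s t)) (fun t => z (s t))
      (fun t => hinj _) (fun t => hz _) (fun T hT => by
        have h := hall (T.map ⟨s, hs⟩) (fun i hi => by
          obtain ⟨t, -, rfl⟩ := Finset.mem_map.1 hi
          exact (e t).2) (hT.map)
        simpa using h)
    have hDs : D s ≠ 0 := fun h => hG' (by rw [← hD G' s, h, map_zero])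
    have hdet := hG (Sum.inl ⟨s, hDs⟩)
    simp only [P, Sum.elim_inl, hD] at hdet
    have hspan : Submodule.span ℝ (Set.range fun t => x (s t)) = ⊤ := by
      refine LinearIndependent.span_eq_top_of_card_eq_finrank' ?_ (by simp)
      exact Matrix.linearIndependent_rows_of_det_ne_zero hdet
    have hmem : L (Pi.single 0 1) ∈
        (Submodule.span ℝ (Set.range fun t => x (s t))).map L :=
      Submodule.mem_map_of_mem (hspan ▸ Submodule.mem_top)
    have hone : L (Pi.single 0 1) = fun _ => (1 : ℝ) := by
      ext q
      change (∑ a, (Pi.single 0 1 : Fin (m + 1) → ℝ) a * G (a, q)) / G (0, q) = 1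
      simp [Pi.single_apply, hG0]
    rw [hone, Submodule.map_span] at hmem
    refine Submodule.span_mono ?_ hmem
    rintro _ ⟨_, ⟨t, rfl⟩, rfl⟩
    exact ⟨s t, (e t).2, rfl⟩

/-- The cyclic interval of length `m` starting at `i`. -/
def cyclicInterval (n m : ℕ) (i : Fin n) : Finset (Fin n) :=
  Finset.univ.filter fun q => ((i : ℕ) ≤ q ∧ (q : ℕ) < i + m) ∨ (q : ℕ) + n < i + m

theorem mem_cyclicInterval {n m : ℕ} {i q : Fin n} : q ∈ cyclicInterval n m i ↔
    ((i : ℕ) ≤ q ∧ (q : ℕ) < i + m) ∨ (q : ℕ) + n < i + m := by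
  simp [cyclicInterval]

theorem card_cyclicInterval {n m : ℕ} (h : m ≤ n) (i : Fin n) :
    (cyclicInterval n m i).card = m := by
  have hi := i.2
  refine ((Finset.card_range m).symm.trans ?_).symm
  refine Finset.card_bij
    (fun j hj => ⟨if i + j < n then i + j else i + j - n, by
      rw [Finset.mem_range] at hj; split_ifs <;> omega⟩) ?_ ?_ ?_
  · intro j hj
    rw [Finset.mem_range] at hj
    rw [mem_cyclicInterval]
    dsimp only
    split_ifs <;> omega
  · intro a ha b hb hab
    rw [Finset.mem_range] at ha hb
    rw [Fin.mk.injEq] at hab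
    split_ifs at hab <;> omega
  · intro q hq
    have hqn := q.2
    rw [mem_cyclicInterval] at hq
    refine ⟨if (i : ℕ) ≤ q then q - i else q + n - i, ?_, ?_⟩
    · rw [Finset.mem_range]; split_ifs <;> omega
    · ext
      dsimp only
      split_ifs <;> omega

/-- Cyclic adjacency: `q` follows `p`. -/
def CyclicSucc {n : ℕ} (p q : Fin n) : Prop :=
  (q : ℕ) = p + 1 ∨ ((q : ℕ) = 0 ∧ (p : ℕ) + 1 = n)

/-- Integer sets `R`, `A` with `0 ≤ r - a < m` for all `r ∈ R`, `a ∈ A`. -/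
theorem card_add_card_le_of_forall_sub_lt {m : ℕ} (R A : Finset ℤ) (hR : R.Nonempty)
    (hA : A.Nonempty) (h : ∀ r ∈ R, ∀ a ∈ A, a ≤ r ∧ r < a + m) :
    R.card + A.card ≤ m + 1 ∧
      (2 ≤ R.card → (∀ r ∈ R, r + 1 ∉ R) → R.card + A.card ≤ m) := by
  have h0 := R.min'_mem hR
  have h1 := R.max'_mem hR
  have h2 := A.min'_mem hA
  set r₀ := R.min' hR
  set r₁ := R.max' hR
  set a₀ := A.min' hA
  have hsub : R ∪ A ⊆ Finset.Icc a₀ r₁ := by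
    intro y hy
    rw [Finset.mem_Icc]
    rcases Finset.mem_union.1 hy with hy | hy
    · exact ⟨(h y hy a₀ h2).1, R.le_max' y hy⟩
    · exact ⟨A.min'_le y hy, (h r₁ h1 y hy).1⟩
  have hint : (R ∩ A).card ≤ 1 := by
    refine Finset.card_le_one.2 fun a ha b hb => ?_
    rw [Finset.mem_inter] at ha hb
    exact le_antisymm (h b hb.1 a ha.2).1 (h a ha.1 b hb.2).1
  have hcard := Finset.card_union_add_card_inter R A
  have hm := (h r₁ h1 a₀ h2)
  constructor
  · have := Finset.card_le_card hsub
    rw [Int.card_Icc] at this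
    omega
  · intro hR2 hns
    have hlt : r₀ < r₁ := Finset.min'_lt_max'_of_card R (by omega)
    have hmem : r₀ + 1 ∈ Finset.Icc a₀ r₁ := by
      rw [Finset.mem_Icc]
      have := (h r₀ h0 a₀ h2)
      omega
    have hnot : r₀ + 1 ∉ R ∪ A := by
      rw [Finset.mem_union, not_or]
      refine ⟨hns r₀ h0, fun hA' => ?_⟩
      have := (h r₀ h0 _ hA').1
      omega
    have := Finset.card_le_card (Finset.insert_subset hmem hsub)
    rw [Finset.card_insert_of_notMem hnot, Int.card_Icc] at this
    omega

theorem card_add_card_le_of_forall_mem_cyclicInterval {n m : ℕ} (hn : 2 * m < n)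
    (R A : Finset (Fin n)) (hA : A.Nonempty)
    (h : ∀ r ∈ R, ∀ a ∈ A, r ∈ cyclicInterval n m a) (hR : R.Nonempty) :
    R.card + A.card ≤ m + 1 ∧
      (2 ≤ R.card → (∀ p ∈ R, ∀ q ∈ R, ¬ CyclicSucc p q) → R.card + A.card ≤ m) := by
  obtain ⟨a₀, ha₀⟩ := hA
  obtain ⟨r₀, hr₀⟩ := hR
  let φ : Fin n → ℤ := fun q => if (a₀ : ℕ) ≤ q then q else q + n
  let ψ : Fin n → ℤ := fun i =>
    if (a₀ : ℕ) + m ≤ i then i - n else if (i : ℕ) + m ≤ a₀ then i + n else i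
  have hφ : Function.Injective φ := by
    intro p q hpq
    have := p.2
    have := q.2
    ext
    simp only [φ] at hpq
    split_ifs at hpq <;> omega
  have hψ : Set.InjOn ψ A := by
    intro p hp q hq hpq
    have := p.2
    have := q.2
    have := r₀.2
    have h1 := mem_cyclicInterval.1 (h r₀ hr₀ p hp)
    have h2 := mem_cyclicInterval.1 (h r₀ hr₀ q hq)
    have h3 := mem_cyclicInterval.1 (h r₀ hr₀ a₀ ha₀)
    ext
    simp only [ψ] at hpq
    split_ifs at hpq <;> omega
  have key := card_add_card_le_of_forall_sub_lt (m := m) (R.image φ) (A.image ψ)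
    ⟨_, Finset.mem_image_of_mem φ hr₀⟩ ⟨_, Finset.mem_image_of_mem ψ ha₀⟩ (by
      simp only [Finset.forall_mem_image]
      intro r hr a ha
      have := r.2
      have := a.2
      have := a₀.2
      have h1 := mem_cyclicInterval.1 (h r hr a ha)
      have h2 := mem_cyclicInterval.1 (h r hr a₀ ha₀)
      simp only [φ, ψ]
      split_ifs <;> omega)
  rw [Finset.card_image_of_injective _ hφ, Finset.card_image_of_injOn hψ] at key
  refine ⟨key.1, fun hR2 hns => key.2 hR2 ?_⟩
  simp only [Finset.forall_mem_image]
  intro p hp hp1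
  obtain ⟨q, hq, hqp⟩ := Finset.mem_image.1 hp1
  refine hns p hp q hq ?_
  have := p.2
  have := q.2
  simp only [φ] at hqp
  unfold CyclicSucc
  split_ifs at hqp <;> omega

/-- Dealing the elements of `U` round-robin to `e ≥ 2` classes of size `m`. -/
theorem exists_disjoint_subsets_not_cyclicSucc {n m e : ℕ} (he : 2 ≤ e) (U : Finset (Fin n))
    (hU : e * m ≤ U.card) :
    ∃ W : Fin e → Finset (Fin n), (∀ j, (W j).card = m) ∧ (∀ j, W j ⊆ U) ∧
      (∀ i j, i ≠ j → Disjoint (W i) (W j)) ∧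
      ∀ j, ∀ p ∈ W j, ∀ q ∈ W j, ¬ CyclicSucc p q := by
  have hlt : ∀ (j : Fin e) (t : Fin m), (j : ℕ) + e * t < U.card := by
    intro j t
    have h1 : e * (t + 1) ≤ e * m := Nat.mul_le_mul_left e t.2
    have := j.2
    rw [Nat.mul_add] at h1
    omega
  let u := U.orderEmbOfFin rfl
  have hmono : ∀ a b : Fin U.card, (a : ℕ) < b → (u a : ℕ) < u b := fun a b hab =>
    u.strictMono hab
  let w : Fin e → Fin m → Fin n := fun j t => u ⟨j + e * t, hlt j t⟩
  have hw : ∀ i j s t, w i s = w j t → i = j ∧ s = t := by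
    intro i j s t h
    have h1 : (i : ℕ) + e * s = j + e * t := by simpa using u.injective h
    have h2 := congrArg (· % e) h1
    simp only [Nat.add_mul_mod_self_left, Nat.mod_eq_of_lt i.2, Nat.mod_eq_of_lt j.2] at h2
    refine ⟨Fin.ext h2, Fin.ext ?_⟩
    have : e * (s : ℕ) = e * t := by omega
    exact Nat.eq_of_mul_eq_mul_left (by omega) this
  refine ⟨fun j => Finset.univ.image (w j), fun j => ?_, fun j => ?_, fun i j hij => ?_,
    fun j => ?_⟩
  · rw [Finset.card_image_of_injective _ fun s t h => (hw j j s t h).2]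
    simp
  · intro q hq
    obtain ⟨t, -, rfl⟩ := Finset.mem_image.1 hq
    exact U.orderEmbOfFin_mem rfl _
  · rw [Finset.disjoint_left]
    intro q hi hj
    obtain ⟨s, -, rfl⟩ := Finset.mem_image.1 hi
    obtain ⟨t, -, h⟩ := Finset.mem_image.1 hj
    exact hij (hw j i t s h).1.symm
  · simp only [Finset.forall_mem_image]
    rintro s - t - (h | ⟨h0, h1⟩)
    · rcases lt_trichotomy (s : ℕ) t with hst | hst | hst
      · have h2 : e * ((s : ℕ) + 1) ≤ e * t := Nat.mul_le_mul_left e hst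
        rw [Nat.mul_add] at h2
        have hb := hlt j t
        have h3 := hmono ⟨j + e * s, hlt j s⟩ ⟨j + e * s + 1, by omega⟩ (by simp)
        have h4 := hmono ⟨j + e * s + 1, by omega⟩ ⟨j + e * t, hb⟩ (by simp; omega)
        simp only [w] at h
        omega
      · have : s = t := Fin.ext hst
        subst this
        omega
      · have h2 : e * (t : ℕ) < e * s := Nat.mul_lt_mul_of_pos_left hst (by omega)
        have h3 := hmono ⟨j + e * t, hlt j t⟩ ⟨j + e * s, hlt j s⟩ (by simp; omega)
        simp only [w] at h
        omega
    · have hj : (j : ℕ) = 0 := by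
        by_contra hj
        have h3 := hmono ⟨0, by have := hlt j t; omega⟩ ⟨j + e * t, hlt j t⟩ (by simp; omega)
        simp only [w] at h0
        omega
      have h2 : e * ((s : ℕ) + 1) ≤ e * m := Nat.mul_le_mul_left e s.2
      rw [Nat.mul_add] at h2
      have h3 := hmono ⟨j + e * s, hlt j s⟩ ⟨j + e * s + 1, by omega⟩ (by simp)
      have h4 := (u ⟨j + e * s + 1, by omega⟩).2
      simp only [w] at h1
      omega

/-- The Hall-type condition for cyclic intervals indexed by a superset `A` of `M` together
with disjoint sets that avoid both cyclic neighbours and the common part over `M`. -/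
theorem card_inter_add_card_le {n m : ℕ} {β : Type*} (hn : 2 * m < n) (M A : Finset (Fin n))
    (hMA : M ⊆ A) (J : Finset β) (W : β → Finset (Fin n)) (hWm : ∀ j ∈ J, (W j).card = m)
    (hWU : ∀ j ∈ J, ∀ q ∈ W j, ∃ i ∈ M, q ∉ cyclicInterval n m i)
    (hWd : ∀ i ∈ J, ∀ j ∈ J, i ≠ j → Disjoint (W i) (W j))
    (hWs : ∀ j ∈ J, ∀ p ∈ W j, ∀ q ∈ W j, ¬ CyclicSucc p q)
    (hcard : A.card + J.card = m + 1)
    (A' : Finset (Fin n)) (hA' : A' ⊆ A) (J' : Finset β) (hJ' : J' ⊆ J)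
    (hne : A'.Nonempty ∨ J'.Nonempty) (R : Finset (Fin n))
    (hRA : ∀ q ∈ R, ∀ i ∈ A', q ∈ cyclicInterval n m i) (hRJ : ∀ q ∈ R, ∀ j ∈ J', q ∈ W j) :
    R.card + (A'.card + J'.card) ≤ m + 1 := by
  have hA'c := Finset.card_le_card hA'
  have hJ'c := Finset.card_le_card hJ'
  rcases R.eq_empty_or_nonempty with rfl | hR
  · rw [Finset.card_empty]
    omega
  obtain ⟨q, hq⟩ := hR
  have hJ1 : J'.card ≤ 1 := Finset.card_le_one.2 fun i hi j hj => by
    by_contra hij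
    exact Finset.disjoint_left.1 (hWd i (hJ' hi) j (hJ' hj) hij) (hRJ q hq i hi) (hRJ q hq j hj)
  rcases J'.eq_empty_or_nonempty with rfl | ⟨j, hj⟩
  · have := (card_add_card_le_of_forall_mem_cyclicInterval hn R A' (by simpa using hne) hRA
      ⟨q, hq⟩).1
    simpa using this
  have hRW : R ⊆ W j := fun p hp => hRJ p hp j hj
  have hRm := Finset.card_le_card hRW
  rw [hWm j (hJ' hj)] at hRm
  rcases A'.eq_empty_or_nonempty with rfl | hA'ne
  · rw [Finset.card_empty]
    omega
  obtain ⟨i, hiM, hi⟩ := hWU j (hJ' hj) q (hRW hq)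
  have hlt : A'.card < A.card := Finset.card_lt_card
    ⟨hA', fun h => hi (hRA q hq i (h (hMA hiM)))⟩
  have hJpos : 0 < J.card := Finset.card_pos.2 ⟨j, hJ' hj⟩
  have h2 := (card_add_card_le_of_forall_mem_cyclicInterval hn R A' hA'ne hRA ⟨q, hq⟩).2
  by_cases hR2 : 2 ≤ R.card
  · have := h2 hR2 fun p hp r hr => hWs j (hJ' hj) p (hRW hp) r (hRW hr)
    omega
  · omega

theorem card_support_le_of_forall_mem_eq_zero {n m : ℕ} {f : Fin n → ℝ} {Z : Finset (Fin n)}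
    (hZ : Z.card = m) (hf : ∀ q ∈ Z, f q = 0) :
    (Finset.univ.filter fun q => f q ≠ 0).card ≤ n - m := by
  have h : (Finset.univ.filter fun q => f q ≠ 0) ⊆ Zᶜ := fun q hq => by
    rw [Finset.mem_compl]
    exact fun hqZ => (Finset.mem_filter.1 hq).2 (hf q hqZ)
  have := Finset.card_le_card h
  rwa [Finset.card_compl, hZ, Fintype.card_fin] at this

/-- For `1 ≤ c < k`, `n₁ ≥ 2(k-1) + (k-c)` and
`n₁ < n₂ ≤ n₁ + ⌊(n₁-k+c)/(k-1)⌋`, there is an `(n₁, n₂, k, c)` tiered gradient code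
with `Q = n₁` partitions whose rows all have support of size at most `n₁ - k + 1`;
its computation per server `(n₁-k+1)/n₁` is strictly smaller than `(n₂-k+1)/n₂`. -/
theorem stmt_18 (k c n₁ n₂ : ℕ) (hk : 2 ≤ k) (hc : 1 ≤ c) (hck : c < k)
    (hn₁ : 2 * (k - 1) + (k - c) ≤ n₁) (h1 : n₁ < n₂)
    (h2 : n₂ ≤ n₁ + (n₁ - k + c) / (k - 1)) :
    ∃ (F : Matrix (Fin n₁) (Fin n₁) ℝ)
      (B : Finset (Fin n₁) → Matrix (Fin (n₂ - n₁)) (Fin n₁) ℝ),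
      (∀ M : Finset (Fin n₁), M.card = c →
        ∀ I₁ : Finset (Fin n₁), Disjoint I₁ M →
          ∀ I₂ : Finset (Fin (n₂ - n₁)), I₁.card + I₂.card = k - c →
            (fun _ => (1 : ℝ)) ∈ Submodule.span ℝ
              ({v : Fin n₁ → ℝ | ∃ i ∈ M ∪ I₁, v = F i} ∪
               {v : Fin n₁ → ℝ | ∃ j ∈ I₂, v = B M j})) ∧
      (∀ i : Fin n₁, (Finset.univ.filter fun q => F i q ≠ 0).card ≤ n₁ - k + 1) ∧
      (∀ M : Finset (Fin n₁), M.card = c → ∀ j : Fin (n₂ - n₁),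
        (Finset.univ.filter fun q => B M j q ≠ 0).card ≤ n₁ - k + 1) ∧
      ((n₁ : ℝ) - (k : ℝ) + 1) / (n₁ : ℝ) < ((n₂ : ℝ) - (k : ℝ) + 1) / (n₂ : ℝ) := by
  obtain ⟨m, rfl⟩ : ∃ m, k = m + 1 := ⟨k - 1, by omega⟩
  rw [Nat.add_sub_cancel] at hn₁ h2
  have hn : 2 * m < n₁ := by omega
  obtain ⟨e, he⟩ : ∃ e, e = max 2 (n₂ - n₁) := ⟨_, rfl⟩
  have he2 : 2 ≤ e := he ▸ le_max_left _ _
  have hle : n₂ - n₁ ≤ e := he ▸ le_max_right _ _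
  have hem : e * m ≤ n₁ - (m + 1 - c) := by
    have h3 : (n₂ - n₁) * m ≤ n₁ - (m + 1) + c :=
      (Nat.mul_le_mul_right m (by omega)).trans (Nat.div_mul_le_self _ m)
    rcases max_cases 2 (n₂ - n₁) with h | h <;> rw [he, h.1] <;> omega
  have hW : ∀ M : Finset (Fin n₁), ∃ W : Fin e → Finset (Fin n₁), (∀ j, (W j).card = m) ∧
      (M.card = c → (∀ j, ∀ q ∈ W j, ∃ i ∈ M, q ∉ cyclicInterval n₁ m i) ∧
        (∀ i j, i ≠ j → Disjoint (W i) (W j)) ∧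
        ∀ j, ∀ p ∈ W j, ∀ q ∈ W j, ¬ CyclicSucc p q) := by
    intro M
    by_cases hM : M.card = c
    · let R : Finset (Fin n₁) := Finset.univ.filter fun q => ∀ i ∈ M, q ∈ cyclicInterval n₁ m i
      have hR : R.card ≤ m + 1 - c := by
        rcases R.eq_empty_or_nonempty with h | h
        · rw [h, Finset.card_empty]
          omega
        · have := (card_add_card_le_of_forall_mem_cyclicInterval hn R M
            (Finset.card_pos.1 (by omega)) (fun q hq => (Finset.mem_filter.1 hq).2) h).1
          omega
      obtain ⟨W, h1, h2, h3⟩ := exists_disjoint_subsets_not_cyclicSucc (m := m) he2 Rᶜ (by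
        rw [Finset.card_compl, Fintype.card_fin]
        omega)
      exact ⟨W, h1, fun _ => ⟨fun j q hq => by simpa [R] using h2 j hq, h3⟩⟩
    · exact ⟨fun _ => cyclicInterval n₁ m ⟨0, by omega⟩,
        fun _ => card_cyclicInterval (by omega) _, fun h => absurd h hM⟩
  choose W hWm hW using hW
  let Z : Fin n₁ ⊕ Finset (Fin n₁) × Fin e → Finset (Fin n₁) :=
    Sum.elim (cyclicInterval n₁ m) fun p => W p.1 p.2
  have hZ : ∀ i, (Z i).card = m := by
    rintro (i | p)
    · exact card_cyclicInterval (by omega) i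
    · exact hWm _ _
  obtain ⟨f, hf0, hf⟩ := exists_rows_one_mem_span Z hZ
  have hsupp : ∀ i, (Finset.univ.filter fun q => f i q ≠ 0).card ≤ n₁ - (m + 1) + 1 := fun i =>
    (card_support_le_of_forall_mem_eq_zero (hZ i) (hf0 i)).trans (by omega)
  refine ⟨fun i => f (Sum.inl i), fun M j => f (Sum.inr (M, Fin.castLE hle j)), ?_,
    fun i => hsupp _, fun M _ j => hsupp _, ?_⟩
  · intro M hM I₁ hI₁ I₂ hI
    obtain ⟨hWU, hWd, hWs⟩ := hW M hM
    let g : Fin (n₂ - n₁) ↪ Finset (Fin n₁) × Fin e :=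
      ⟨fun j => (M, Fin.castLE hle j), fun i j h => by simpa using h⟩
    have hJ : ∀ p ∈ I₂.map g, p.1 = M := by
      intro p hp
      obtain ⟨j, -, rfl⟩ := Finset.mem_map.1 hp
      rfl
    have hcard : (M ∪ I₁).card + (I₂.map g).card = m + 1 := by
      rw [Finset.card_union_of_disjoint hI₁.symm, Finset.card_map]
      omega
    refine Submodule.span_mono ?_ (hf ((M ∪ I₁).disjSum (I₂.map g)) ?_ ?_)
    · rintro _ ⟨x, hx, rfl⟩
      rcases Finset.mem_disjSum.1 hx with ⟨i, hi, rfl⟩ | ⟨p, hp, rfl⟩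
      · exact Or.inl ⟨i, hi, rfl⟩
      · obtain ⟨j, hj, rfl⟩ := Finset.mem_map.1 hp
        exact Or.inr ⟨j, hj, rfl⟩
    · rw [Finset.card_disjSum, hcard]
    · intro T hT hTne
      rw [← Finset.card_toLeft_add_card_toRight (u := T)]
      refine card_inter_add_card_le hn M (M ∪ I₁) Finset.subset_union_left (I₂.map g)
        (fun p => W p.1 p.2) (fun p _ => hWm _ _) ?_ ?_ ?_ hcard T.toLeft ?_ T.toRight ?_ ?_ _
        ?_ ?_
      · rintro ⟨M', j⟩ hp
        obtain rfl : M' = M := hJ _ hp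
        exact hWU j
      · rintro ⟨M', i⟩ hp ⟨M'', j⟩ hp' hne
        obtain rfl : M' = M := hJ _ hp
        obtain rfl : M'' = M' := hJ _ hp'
        exact hWd i j fun h => hne (by rw [h])
      · rintro ⟨M', j⟩ hp
        obtain rfl : M' = M := hJ _ hp
        exact hWs j
      · intro i hi
        simpa using hT (Finset.mem_toLeft.1 hi)
      · intro p hp
        exact Finset.inr_mem_disjSum.1 (hT (Finset.mem_toRight.1 hp))
      · obtain ⟨i | p, hx⟩ := hTne
        · exact Or.inl ⟨i, Finset.mem_toLeft.2 hx⟩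
        · exact Or.inr ⟨p, Finset.mem_toRight.2 hx⟩
      · intro q hq i hi
        simp only [Finset.mem_filter_univ] at hq
        exact hq _ (Finset.mem_toLeft.1 hi)
      · intro q hq p hp
        simp only [Finset.mem_filter_univ] at hq
        exact hq _ (Finset.mem_toRight.1 hp)
  · have h₁ : (0 : ℝ) < n₁ := by exact_mod_cast (by omega : 0 < n₁)
    have h₂ : (n₁ : ℝ) < n₂ := by exact_mod_cast h1
    have h₃ : (0 : ℝ) < m := by exact_mod_cast (by omega : 0 < m)
    push_cast
    rw [div_lt_div_iff₀ h₁ (h₁.trans h₂)]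
    nlinarith
end

section
/- Let k ≥ 2 and 1 ≤ c < k be integers, let n₁ ≥ 2(k−1) + (k−c), and let n₂ > n₁. Set p* = max(0, (n₂ − n₁) − ⌊(n₂ − k + c)/k⌋). Then n₂ ≤ (n₁ + p*) + ⌊(n₁ + p* − k + c)/(k−1)⌋, and there exists an (n₁, n₂, k, c) tiered gradient code with Q = n₁ + p* data partitions in which every row of F and every row of each B_M has support of size at most (n₁ + p*) − k + 1; hence its computation per server is (n₁ + p* − k + 1)/(n₁ + p*). -/
/-- The signed maximal minors of the columns `z` of `G`: a vector orthogonal to these columns. -/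
def cofactorVec {R : Type*} [CommRing R] {m N : ℕ} (G : Matrix (Fin (m + 1)) (Fin N) R)
    (z : Fin m → Fin N) (l : Fin (m + 1)) : R :=
  (-1) ^ (l : ℕ) * (G.submatrix l.succAbove z).det

theorem sum_cofactorVec_mul_eq_zero {R : Type*} [CommRing R] {m N : ℕ}
    (G : Matrix (Fin (m + 1)) (Fin N) R) (z : Fin m → Fin N) (t : Fin m) :
    ∑ l, cofactorVec G z l * G l (z t) = 0 := by
  have h := Matrix.det_succ_column_zero
    (Matrix.of fun l => (Fin.cons (G l (z t)) (fun t => G l (z t)) : Fin (m + 1) → R))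
  rw [Matrix.det_zero_of_column_eq (Fin.succ_ne_zero t).symm (by simp)] at h
  rw [h]
  refine Finset.sum_congr rfl fun l _ => ?_
  have : (Matrix.of fun l => (Fin.cons (G l (z t)) (fun t => G l (z t)) :
      Fin (m + 1) → R)).submatrix l.succAbove Fin.succ = G.submatrix l.succAbove z := by
    ext a b; simp
  rw [this, cofactorVec]
  simp only [Matrix.of_apply, Fin.cons_zero]
  ring

theorem map_cofactorVec {R S : Type*} [CommRing R] [CommRing S] (f : R →+* S) {m N : ℕ}
    (G : Matrix (Fin (m + 1)) (Fin N) R) (z : Fin m → Fin N) (l : Fin (m + 1)) :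
    f (cofactorVec G z l) = cofactorVec (G.map f) z l := by
  simp [cofactorVec, RingHom.map_det, Matrix.submatrix_map]

/-- The determinant of the `m + 1` vectors `cofactorVec G (z i)`. -/
def cofactorDet {R : Type*} [CommRing R] {m N : ℕ} (G : Matrix (Fin (m + 1)) (Fin N) R)
    (z : Fin (m + 1) → Fin m → Fin N) : R :=
  (Matrix.of fun i => cofactorVec G (z i)).det

theorem map_cofactorDet {R S : Type*} [CommRing R] [CommRing S] (f : R →+* S) {m N : ℕ}
    (G : Matrix (Fin (m + 1)) (Fin N) R) (z : Fin (m + 1) → Fin m → Fin N) :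
    f (cofactorDet G z) = cofactorDet (G.map f) z := by
  rw [cofactorDet, RingHom.map_det, cofactorDet]
  congr 1
  ext i l
  simp [map_cofactorVec]

/-- The Hall-type condition on zero patterns: every nonempty set `I` of patterns shares at most
`m + 1 - #I` positions. -/
def IsHallPattern {m N : ℕ} (z : Fin (m + 1) → Fin m → Fin N) : Prop :=
  (∀ i, Function.Injective (z i)) ∧ ∀ I : Finset (Fin (m + 1)), I.Nonempty →
    (Finset.univ.filter fun q => ∀ i ∈ I, q ∈ Set.range (z i)).card + I.card ≤ m + 1

theorem IsHallPattern.exists_matching {m N : ℕ} {z : Fin (m + 1) → Fin m → Fin N}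
    (hz : IsHallPattern z) (i : Fin (m + 1)) :
    ∃ f : Fin m → Fin m, Function.Injective f ∧
      ∀ t, z i (f t) ∉ Set.range (z (i.succAbove t)) := by
  classical
  obtain ⟨f, hf, hft⟩ := (Finset.all_card_le_biUnion_card_iff_exists_injective
    (fun t : Fin m => Finset.univ.filter fun u : Fin m =>
      z i u ∉ Set.range (z (i.succAbove t)))).1 (by
    intro s
    have h := hz.2 (insert i (s.map i.succAboveEmb)) (Finset.insert_nonempty _ _)
    rw [Finset.card_insert_of_notMem (by simp [Fin.succAbove_ne]), Finset.card_map] at h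
    have h2 : ((s.biUnion fun t : Fin m => Finset.univ.filter fun u : Fin m =>
        z i u ∉ Set.range (z (i.succAbove t)))ᶜ).card ≤
        (Finset.univ.filter fun q =>
          ∀ l ∈ insert i (s.map i.succAboveEmb), q ∈ Set.range (z l)).card := by
      refine Finset.card_le_card_of_injOn (z i) ?_ (hz.1 i).injOn
      intro u hu
      simp only [Finset.coe_compl, Set.mem_compl_iff, Finset.mem_coe, Finset.mem_biUnion,
        Finset.mem_filter, Finset.mem_univ, true_and, not_exists, not_and, not_not] at hu
      simp only [Finset.coe_filter, Finset.mem_univ, true_and, Set.mem_ofPred_eq,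
        Finset.forall_mem_insert, Finset.mem_map, forall_exists_index, and_imp]
      refine ⟨⟨u, rfl⟩, ?_⟩
      rintro _ t ht rfl
      exact hu t ht
    rw [Finset.card_compl, Fintype.card_fin] at h2
    omega)
  exact ⟨f, hf, fun t => by simpa using hft t⟩

/-- The generic matrix whose row `i` vanishes on the pattern `z i`. -/
noncomputable def patternMatrix {m N : ℕ} (z : Fin (m + 1) → Fin m → Fin N) :
    Matrix (Fin (m + 1)) (Fin N) (MvPolynomial (Fin (m + 1) × Fin N) ℝ) :=
  open Classical in
  Matrix.of fun i q => if q ∈ Set.range (z i) then 0 else MvPolynomial.X (i, q)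

theorem IsHallPattern.det_submatrix_patternMatrix_ne_zero {m N : ℕ}
    {z : Fin (m + 1) → Fin m → Fin N} (hz : IsHallPattern z) (i : Fin (m + 1)) :
    ((patternMatrix z).submatrix i.succAbove (z i)).det ≠ 0 := by
  classical
  obtain ⟨f, hf, hft⟩ := hz.exists_matching i
  intro h0
  let σ : Equiv.Perm (Fin m) := Equiv.ofBijective f (Finite.injective_iff_bijective.1 hf)
  let x : Fin (m + 1) × Fin N → ℝ := fun p => if ∃ t, p = (i.succAbove t, z i (f t)) then 1 else 0
  have h := congrArg (MvPolynomial.eval x) h0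
  rw [RingHom.map_det, map_zero] at h
  have hP : (MvPolynomial.eval x).mapMatrix ((patternMatrix z).submatrix i.succAbove (z i)) =
      (Equiv.toPEquiv σ).toMatrix := by
    ext a b
    simp only [RingHom.mapMatrix_apply, Matrix.map_apply, Matrix.submatrix_apply, patternMatrix,
      Matrix.of_apply, PEquiv.toMatrix_apply, Equiv.toPEquiv_apply, Option.mem_some_iff]
    by_cases hab : f a = b
    · subst hab
      rw [if_neg (hft a), MvPolynomial.eval_X, if_pos (show σ a = f a from rfl)]
      exact if_pos ⟨a, rfl⟩
    · rw [if_neg (show ¬ σ a = b from hab)]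
      split_ifs
      · simp
      · rw [MvPolynomial.eval_X]
        refine if_neg ?_
        rintro ⟨t, ht⟩
        rw [Prod.mk.injEq, Fin.succAbove_right_inj] at ht
        obtain ⟨rfl, h2⟩ := ht
        exact hab (hz.1 i h2).symm
  rw [hP, Matrix.det_permutation] at h
  rcases Int.units_eq_one_or (Equiv.Perm.sign σ) with h1 | h1 <;> simp [h1] at h

theorem IsHallPattern.cofactorDet_patternMatrix_ne_zero {m N : ℕ}
    {z : Fin (m + 1) → Fin m → Fin N} (hz : IsHallPattern z) :
    cofactorDet (patternMatrix z) z ≠ 0 := by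
  have h : (Matrix.of fun i => cofactorVec (patternMatrix z) (z i)) =
      Matrix.diagonal fun i => cofactorVec (patternMatrix z) (z i) i := by
    ext1 i l
    rw [Matrix.of_apply]
    by_cases hil : i = l
    · subst hil
      simp
    · obtain ⟨a, ha⟩ := Fin.exists_succAbove_eq hil
      rw [Matrix.diagonal_apply_ne _ hil, cofactorVec, Matrix.det_eq_zero_of_row_eq_zero a,
        mul_zero]
      intro b
      rw [Matrix.submatrix_apply, ha]
      simp [patternMatrix]
  rw [cofactorDet, h, Matrix.det_diagonal, Finset.prod_ne_zero_iff]
  intro i _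
  exact mul_ne_zero (by simp) (hz.det_submatrix_patternMatrix_ne_zero i)

/-- A sufficiently generic matrix works simultaneously for all Hall patterns. -/
theorem exists_matrix_forall_cofactorDet_ne_zero (m N : ℕ) :
    ∃ G : Matrix (Fin (m + 1)) (Fin N) ℝ, (∀ q, G 0 q ≠ 0) ∧
      ∀ z : Fin (m + 1) → Fin m → Fin N, IsHallPattern z → cofactorDet G z ≠ 0 := by
  classical
  let X : Matrix (Fin (m + 1)) (Fin N) (MvPolynomial (Fin (m + 1) × Fin N) ℝ) :=
    Matrix.of fun i q => MvPolynomial.X (i, q)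
  have hX : ∀ z, IsHallPattern z → cofactorDet X z ≠ 0 := by
    intro z hz h0
    apply hz.cofactorDet_patternMatrix_ne_zero
    have h := congrArg
      (MvPolynomial.eval₂Hom MvPolynomial.C fun p => patternMatrix z p.1 p.2) h0
    rw [map_cofactorDet, map_zero] at h
    rw [← h]
    congr 1
    ext1 i q
    simp [X]
  have hP : (∏ q, X 0 q) * ∏ z with IsHallPattern z, cofactorDet X z ≠ 0 := by
    refine mul_ne_zero (Finset.prod_ne_zero_iff.2 fun q _ => MvPolynomial.X_ne_zero _)
      (Finset.prod_ne_zero_iff.2 fun z hz => hX z (Finset.mem_filter.1 hz).2)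
  obtain ⟨x, hx⟩ : ∃ x, MvPolynomial.eval x
      ((∏ q, X 0 q) * ∏ z with IsHallPattern z, cofactorDet X z) ≠ 0 := by
    by_contra! hcon
    exact hP (MvPolynomial.funext fun x => by rw [hcon x, map_zero])
  rw [map_mul, map_prod, map_prod, mul_ne_zero_iff, Finset.prod_ne_zero_iff,
    Finset.prod_ne_zero_iff] at hx
  refine ⟨X.map (MvPolynomial.eval x), fun q => hx.1 q (Finset.mem_univ q), fun z hz => ?_⟩
  rw [← map_cofactorDet]
  exact hx.2 z (by simpa using hz)

/-- There are vectors `row Z`, one for each `m`-set `Z`, vanishing on `Z`, such that the all-ones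
vector is spanned by any `m + 1` of them whose zero sets satisfy the Hall-type condition. -/
theorem exists_row_one_mem_span (m N : ℕ) :
    ∃ row : Finset (Fin N) → Fin N → ℝ,
      (∀ Z, Z.card = m → ∀ q ∈ Z, row Z q = 0) ∧
      ∀ (ι : Type) (Z : ι → Finset (Fin N)) (T : Finset ι), T.card = m + 1 →
        (∀ i ∈ T, (Z i).card = m) →
        (∀ I ⊆ T, I.Nonempty →
          (Finset.univ.filter fun q => ∀ i ∈ I, q ∈ Z i).card + I.card ≤ m + 1) →
        (fun _ => (1 : ℝ)) ∈ Submodule.span ℝ ((fun i => row (Z i)) '' T) := by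
  classical
  obtain ⟨G, hG0, hG⟩ := exists_matrix_forall_cofactorDet_ne_zero m N
  let row : Finset (Fin N) → Fin N → ℝ := fun Z q =>
    if h : Z.card = m then (∑ l, cofactorVec G (Z.orderEmbOfFin h) l * G l q) / G 0 q else 0
  refine ⟨row, ?_, ?_⟩
  · intro Z hZ q hq
    obtain ⟨t, rfl⟩ : q ∈ Set.range (Z.orderEmbOfFin hZ) := by
      rw [Finset.range_orderEmbOfFin]; exact hq
    simp only [row, dif_pos hZ, sum_cofactorVec_mul_eq_zero, zero_div]
  · intro ι Z T hT hZ hI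
    let e : Fin (m + 1) ≃ T := (T.equivFinOfCardEq hT).symm
    let z : Fin (m + 1) → Fin m → Fin N := fun i =>
      (Z (e i)).orderEmbOfFin (hZ _ (e i).2)
    have hmem : ∀ i q, q ∈ Set.range (z i) ↔ q ∈ Z (e i) := by
      intro i q
      simp only [z, Finset.range_orderEmbOfFin, Finset.mem_coe]
    have hz : IsHallPattern z := by
      refine ⟨fun i => (Finset.orderEmbOfFin _ _).injective, fun I hne => ?_⟩
      have h := hI (I.map (e.toEmbedding.trans (Function.Embedding.subtype _)))
        (by intro x hx; simp only [Finset.mem_map] at hx; obtain ⟨i, _, rfl⟩ := hx; exact (e i).2)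
        (by simpa using hne)
      rw [Finset.card_map] at h
      convert h using 3
      ext q
      simp [hmem]
    have hdet : IsUnit (Matrix.of fun i => cofactorVec G (z i)) :=
      (Matrix.isUnit_iff_isUnit_det _).2 (isUnit_iff_ne_zero.2 (hG z hz))
    obtain ⟨w, hw⟩ := (Matrix.vecMul_surjective_iff_isUnit.2 hdet) (Pi.single 0 1)
    have hone : (fun _ => (1 : ℝ)) = ∑ i, w i • row (Z (e i)) := by
      ext q
      simp only [Finset.sum_apply, Pi.smul_apply, smul_eq_mul, row]
      have h1 : ∀ i, w i * (if h : (Z (e i)).card = m then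
          (∑ l, cofactorVec G ((Z (e i)).orderEmbOfFin h) l * G l q) / G 0 q else 0) =
          (∑ l, w i * cofactorVec G (z i) l * G l q) / G 0 q := by
        intro i
        rw [dif_pos (hZ _ (e i).2), ← mul_div_assoc, Finset.mul_sum]
        simp only [mul_assoc, z]
      simp_rw [h1]
      rw [← Finset.sum_div, Finset.sum_comm, eq_comm, div_eq_one_iff_eq (hG0 q)]
      have h2 : ∀ l, ∑ i, w i * cofactorVec G (z i) l = (Pi.single 0 1 : Fin (m + 1) → ℝ) l := by
        intro l
        rw [← hw]
        rfl
      simp_rw [← Finset.sum_mul, h2]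
      simp [Pi.single_apply]
    rw [hone]
    exact Submodule.sum_mem _ fun i _ => Submodule.smul_mem _ _
      (Submodule.subset_span ⟨e i, (e i).2, rfl⟩)

/-- The cyclic interval of length `L` starting at `a`. -/
def cyclicArc {N : ℕ} (a : Fin N) (L : ℕ) : Finset (Fin N) :=
  Finset.univ.filter fun q => (q - a).val < L

theorem mem_cyclicArc {N : ℕ} {a q : Fin N} {L : ℕ} : q ∈ cyclicArc a L ↔ (q - a).val < L := by
  simp [cyclicArc]

theorem Fin.val_sub_add_sub {N : ℕ} [NeZero N] (q a b : Fin N) :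
    (q - b).val = ((q - a).val + (a - b).val) % N := by
  rw [← Fin.val_add, sub_add_sub_cancel]

theorem card_cyclicArc {N : ℕ} [NeZero N] (a : Fin N) (L : ℕ) :
    (cyclicArc a L).card = min N L := by
  rw [← Fin.card_filter_val_lt, cyclicArc]
  refine Finset.card_equiv (Equiv.subRight a) fun q => ?_
  simp

/-- Distinct arcs of length `m` with a common point meet inside a correspondingly shorter arc. -/
theorem exists_arc_of_mem_arcs {N m : ℕ} [NeZero N] (hN : 2 * m ≤ N) {S : Finset (Fin N)}
    (hS : S.Nonempty) {p : Fin N} (hp : ∀ i ∈ S, p ∈ cyclicArc i m) :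
    S.card ≤ m ∧ ∃ a, ∀ q, (∀ i ∈ S, q ∈ cyclicArc i m) → q ∈ cyclicArc a (m + 1 - S.card) := by
  obtain ⟨i₁, hi₁, hmin⟩ := Finset.exists_min_image S (fun i => (p - i).val) hS
  obtain ⟨i₂, hi₂, hmax⟩ := Finset.exists_max_image S (fun i => (p - i).val) hS
  have hcard : S.card ≤ (Finset.Icc (p - i₁).val (p - i₂).val).card := by
    refine Finset.card_le_card_of_injOn (fun i => (p - i).val)
      (fun i hi => Finset.mem_coe.2 (Finset.mem_Icc.2 ⟨hmin i hi, hmax i hi⟩)) ?_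
    intro i _ j _ hij
    exact sub_right_injective (Fin.val_injective hij)
  rw [Nat.card_Icc] at hcard
  have h1 := hmin i₂ hi₂
  have h2 := mem_cyclicArc.1 (hp i₂ hi₂)
  refine ⟨by omega, i₁, fun q hq => ?_⟩
  have h3 := mem_cyclicArc.1 (hq i₁ hi₁)
  have h4 := mem_cyclicArc.1 (hq i₂ hi₂)
  have h5 := Fin.val_sub_add_sub p i₁ i₂
  have h6 := Fin.val_sub_add_sub q i₁ i₂
  have h7 := (i₁ - i₂).isLt
  rw [mem_cyclicArc]
  rcases lt_or_ge ((p - i₁).val + (i₁ - i₂).val) N with h8 | h8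
  · rw [Nat.mod_eq_of_lt h8] at h5
    rw [Nat.mod_eq_of_lt (by omega)] at h6
    omega
  · rw [Nat.mod_eq_sub_mod h8, Nat.mod_eq_of_lt (by omega)] at h5
    omega

/-- The equally spaced set `a + g + j + e * t`, `t < m`. -/
def spacedSet {N : ℕ} (a : Fin N) (m g e j : ℕ) : Finset (Fin N) :=
  Finset.univ.filter fun q => ∃ t < m, (q - a).val = g + j + e * t

theorem mem_spacedSet {N : ℕ} {a q : Fin N} {m g e j : ℕ} :
    q ∈ spacedSet a m g e j ↔ ∃ t < m, (q - a).val = g + j + e * t := by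
  simp [spacedSet]

theorem add_add_mul_lt {N m g e j t : ℕ} (hN : g + e * m ≤ N) (hj : j < e) (ht : t < m) :
    g + j + e * t < N := by
  have : e * (t + 1) ≤ e * m := Nat.mul_le_mul_left e ht
  rw [mul_add, mul_one] at this
  omega

theorem card_spacedSet {N : ℕ} [NeZero N] (a : Fin N) {m g e j : ℕ} (hN : g + e * m ≤ N)
    (hj : j < e) : (spacedSet a m g e j).card = m := by
  have h : spacedSet a m g e j = Finset.univ.image
      fun t : Fin m => (⟨g + j + e * t, add_add_mul_lt hN hj t.2⟩ : Fin N) + a := by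
    ext q
    simp only [mem_spacedSet, Finset.mem_image, Finset.mem_univ, true_and]
    constructor
    · rintro ⟨t, ht, h⟩
      exact ⟨⟨t, ht⟩, eq_sub_iff_add_eq.1 (Fin.ext h.symm)⟩
    · rintro ⟨t, rfl⟩
      exact ⟨t, t.2, by rw [add_sub_cancel_right]⟩
  rw [h, Finset.card_image_of_injective, Finset.card_univ, Fintype.card_fin]
  intro t u htu
  have h1 := congrArg Fin.val (add_right_cancel htu)
  simp only [add_right_inj] at h1
  exact Fin.ext (Nat.eq_of_mul_eq_mul_left (by omega) h1)

theorem eq_of_mem_spacedSet {N : ℕ} {a q : Fin N} {m g e j j' : ℕ} (hj : j < e) (hj' : j' < e)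
    (h : q ∈ spacedSet a m g e j) (h' : q ∈ spacedSet a m g e j') : j = j' := by
  obtain ⟨t, -, h⟩ := mem_spacedSet.1 h
  obtain ⟨u, -, h'⟩ := mem_spacedSet.1 h'
  have : j + e * t = j' + e * u := by omega
  have := congrArg (· % e) this
  simpa [Nat.mod_eq_of_lt hj, Nat.mod_eq_of_lt hj'] using this

theorem notMem_spacedSet_add_one {N : ℕ} [NeZero N] {a b : Fin N} {m g e j : ℕ} (hg : 0 < g)
    (he : 2 ≤ e) (h : b ∈ spacedSet a m g e j) : b + 1 ∉ spacedSet a m g e j := by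
  intro h'
  obtain ⟨t, -, h⟩ := mem_spacedSet.1 h
  obtain ⟨u, -, h'⟩ := mem_spacedSet.1 h'
  have h1 : (b + 1 - a).val = ((b - a).val + 1) % N := by
    rw [add_sub_right_comm, Fin.val_add, Fin.val_one', Nat.add_mod_mod]
  have h2 := (b - a).isLt
  rcases Nat.lt_or_ge ((b - a).val + 1) N with h3 | h3
  · rw [Nat.mod_eq_of_lt h3, h, h'] at h1
    have h4 : e * u = e * t + 1 := by omega
    have h5 := congrArg (· % e) h4
    simp [Nat.mod_eq_of_lt he] at h5
  · rw [show (b - a).val + 1 = N by omega, Nat.mod_self] at h1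
    omega

theorem card_spacedSet_inter_arc_add_one_le {N : ℕ} [NeZero N] {a b : Fin N} {m g e j L : ℕ}
    (hg : 0 < g) (he : 2 ≤ e) (hN : 2 ≤ N) (hL : 2 ≤ L) :
    (spacedSet a m g e j ∩ cyclicArc b L).card + 1 ≤ L := by
  have hb : b ∈ cyclicArc b L := by rw [mem_cyclicArc, sub_self, Fin.val_zero]; omega
  have hb' : b + 1 ∈ cyclicArc b L := by
    rw [mem_cyclicArc, add_sub_cancel_left, Fin.val_one', Nat.mod_eq_of_lt hN]
    omega
  have hlt : (spacedSet a m g e j ∩ cyclicArc b L).card < (cyclicArc b L).card := by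
    refine Finset.card_lt_card (Finset.ssubset_iff_subset_ne.2 ⟨Finset.inter_subset_right, ?_⟩)
    intro heq
    rw [← heq, Finset.mem_inter] at hb hb'
    exact notMem_spacedSet_add_one hg he hb.1 hb'.1
  rw [card_cyclicArc] at hlt
  omega

/-- The zero sets of the cyclic rows, and of the additional rows attached to the arc at `a`. -/
def zeroSet {N : ℕ} (m g e E : ℕ) (a : Fin N) : Fin N ⊕ Fin E → Finset (Fin N) :=
  Sum.elim (fun i => cyclicArc i m) (fun j => spacedSet a m g e j)

theorem card_zeroSet {N : ℕ} [NeZero N] {m g e E : ℕ} (a : Fin N) (hm : m ≤ N)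
    (hN : g + e * m ≤ N) (hE : E ≤ e) (x : Fin N ⊕ Fin E) : (zeroSet m g e E a x).card = m := by
  rcases x with i | j
  · simp [zeroSet, card_cyclicArc, hm]
  · exact card_spacedSet a hN (j.2.trans_le hE)

theorem card_filter_mem_zeroSet_add_card_le {N : ℕ} [NeZero N] {m g e E : ℕ} {a : Fin N}
    (hm : 0 < m) (hg : 0 < g) (he : 2 ≤ e) (hE : E ≤ e) (hN : g + e * m ≤ N)
    {M : Finset (Fin N)} (hM : ∀ q, (∀ i ∈ M, q ∈ cyclicArc i m) → q ∈ cyclicArc a g)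
    {T : Finset (Fin N ⊕ Fin E)} (hT : T.card = m + 1) (hMT : ∀ i ∈ M, Sum.inl i ∈ T)
    {I : Finset (Fin N ⊕ Fin E)} (hI : I ⊆ T) (hne : I.Nonempty) :
    (Finset.univ.filter fun q => ∀ x ∈ I, q ∈ zeroSet m g e E a x).card + I.card ≤ m + 1 := by
  classical
  have hN2 : 2 * m ≤ N := by nlinarith
  have hIcard := Finset.card_le_card hI
  obtain ⟨C, hC⟩ : ∃ C, C = Finset.univ.filter fun q => ∀ x ∈ I, q ∈ zeroSet m g e E a x :=
    ⟨_, rfl⟩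
  rw [← hC]
  rcases C.eq_empty_or_nonempty with h0 | ⟨p, hp⟩
  · rw [h0, Finset.card_empty]
    omega
  have hmemC : ∀ q, q ∈ C ↔ ∀ x ∈ I, q ∈ zeroSet m g e E a x := by simp [hC]
  have hl : ∀ q ∈ C, ∀ i ∈ I.toLeft, q ∈ cyclicArc i m := fun q hq i hi =>
    (hmemC q).1 hq _ (Finset.mem_toLeft.1 hi)
  have hr : ∀ q ∈ C, ∀ j ∈ I.toRight, q ∈ spacedSet a m g e j := fun q hq j hj =>
    (hmemC q).1 hq _ (Finset.mem_toRight.1 hj)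
  have hsum := Finset.card_toLeft_add_card_toRight (u := I)
  have hr1 : I.toRight.card ≤ 1 := by
    refine Finset.card_le_one.2 fun j hj j' hj' => Fin.ext ?_
    exact eq_of_mem_spacedSet (j.2.trans_le hE) (j'.2.trans_le hE) (hr p hp j hj) (hr p hp j' hj')
  rcases I.toRight.eq_empty_or_nonempty with hr0 | ⟨j, hj⟩
  · rw [hr0, Finset.card_empty] at hsum
    have hlne : I.toLeft.Nonempty := by
      rw [← Finset.card_pos] at hne ⊢
      omega
    obtain ⟨hS, b, hb⟩ := exists_arc_of_mem_arcs hN2 hlne (hl p hp)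
    have h1 := Finset.card_le_card (fun q hq => hb q (hl q hq) : C ⊆ _)
    rw [card_cyclicArc] at h1
    omega
  · have h2 := Finset.card_pos.2 ⟨j, hj⟩
    have hCY : C ⊆ spacedSet a m g e j := fun q hq => hr q hq j hj
    have hCcard := Finset.card_le_card hCY
    rw [card_spacedSet a hN (j.2.trans_le hE)] at hCcard
    rcases I.toLeft.eq_empty_or_nonempty with hl0 | hlne
    · rw [hl0, Finset.card_empty] at hsum
      omega
    obtain ⟨hS, b, hb⟩ := exists_arc_of_mem_arcs hN2 hlne (hl p hp)
    rcases hS.lt_or_eq with hlt | heq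
    · have h3 := card_spacedSet_inter_arc_add_one_le (a := a) (b := b) (m := m) (j := j)
        (L := m + 1 - I.toLeft.card) hg he (by omega) (by omega)
      have h4 := Finset.card_le_card (Finset.subset_inter hCY fun q hq => hb q (hl q hq))
      omega
    · have hIT : I = T := Finset.eq_of_subset_of_card_le hI (by omega)
      obtain ⟨t, -, ht⟩ := mem_spacedSet.1 (hCY hp)
      have h3 := mem_cyclicArc.1 (hM p fun i hi =>
        hl p hp i (Finset.mem_toLeft.2 (hIT ▸ hMT i hi)))
      omega

/-- The second-phase zero sets can be adapted to every set `M` of finished cyclic rows. -/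
theorem exists_arc_start {N m : ℕ} [NeZero N] (hN : 2 * m ≤ N) {M : Finset (Fin N)}
    (hM : M.Nonempty) :
    ∃ a, ∀ q, (∀ i ∈ M, q ∈ cyclicArc i m) → q ∈ cyclicArc a (m + 1 - M.card) := by
  by_cases h : ∃ p, ∀ i ∈ M, p ∈ cyclicArc i m
  · obtain ⟨p, hp⟩ := h
    exact (exists_arc_of_mem_arcs hN hM hp).2
  · exact ⟨0, fun q hq => absurd ⟨q, hq⟩ h⟩

theorem card_filter_ne_zero_le {N m : ℕ} {v : Fin N → ℝ} {Z : Finset (Fin N)} (hZ : Z.card = m)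
    (hv : ∀ q ∈ Z, v q = 0) : (Finset.univ.filter fun q => v q ≠ 0).card ≤ N - m := by
  calc (Finset.univ.filter fun q => v q ≠ 0).card ≤ Zᶜ.card := by
        refine Finset.card_le_card fun q hq => Finset.mem_compl.2 fun hqZ => ?_
        exact (Finset.mem_filter.1 hq).2 (hv q hqZ)
    _ = N - m := by rw [Finset.card_compl, Fintype.card_fin, hZ]

/-- For `1 ≤ c < k`, `n₁ ≥ 2(k-1) + (k-c)` and `n₂ > n₁`, with
`p* = max(0, (n₂-n₁) - ⌊(n₂-k+c)/k⌋)` (here realized by truncated ℕ-subtraction),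
one has `n₂ ≤ (n₁+p*) + ⌊(n₁+p*-k+c)/(k-1)⌋` and there is an `(n₁, n₂, k, c)` tiered
gradient code with `Q = n₁ + p*` partitions whose rows all have support of size at
most `(n₁+p*) - k + 1`; its computation per server is `(n₁+p*-k+1)/(n₁+p*)`. -/
theorem stmt_19 (k c n₁ n₂ : ℕ) (hk : 2 ≤ k) (hc : 1 ≤ c) (hck : c < k)
    (hn₁ : 2 * (k - 1) + (k - c) ≤ n₁) (h1 : n₁ < n₂)
    (pstar : ℕ) (hpstar : pstar = (n₂ - n₁) - (n₂ - k + c) / k) :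
    n₂ ≤ (n₁ + pstar) + (n₁ + pstar - k + c) / (k - 1) ∧
    ∃ (F : Matrix (Fin n₁) (Fin (n₁ + pstar)) ℝ)
      (B : Finset (Fin n₁) → Matrix (Fin (n₂ - n₁)) (Fin (n₁ + pstar)) ℝ),
      (∀ M : Finset (Fin n₁), M.card = c →
        ∀ I₁ : Finset (Fin n₁), Disjoint I₁ M →
          ∀ I₂ : Finset (Fin (n₂ - n₁)), I₁.card + I₂.card = k - c →
            (fun _ => (1 : ℝ)) ∈ Submodule.span ℝ
              ({v : Fin (n₁ + pstar) → ℝ | ∃ i ∈ M ∪ I₁, v = F i} ∪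
               {v : Fin (n₁ + pstar) → ℝ | ∃ j ∈ I₂, v = B M j})) ∧
      (∀ i : Fin n₁,
        (Finset.univ.filter fun q => F i q ≠ 0).card ≤ (n₁ + pstar) - k + 1) ∧
      (∀ M : Finset (Fin n₁), M.card = c → ∀ j : Fin (n₂ - n₁),
        (Finset.univ.filter fun q => B M j q ≠ 0).card ≤ (n₁ + pstar) - k + 1) := by
  have hkpos : 0 < k := by omega
  have hD : (n₂ - k + c) / k * k ≤ n₂ - k + c := Nat.div_mul_le_self _ _
  obtain ⟨N, hNdef⟩ : ∃ N, N = n₁ + pstar := ⟨_, rfl⟩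
  rw [← hNdef]
  obtain ⟨m, rfl⟩ : ∃ m, k = m + 1 := ⟨k - 1, by omega⟩
  obtain ⟨D, hDdef⟩ : ∃ D, D = (n₂ - (m + 1) + c) / (m + 1) := ⟨_, rfl⟩
  rw [← hDdef] at hD hpstar
  obtain ⟨E, hE⟩ : ∃ E, n₂ = N + E := ⟨n₂ - N, by omega⟩
  have hED : E ≤ D := by omega
  have hEm : (m + 1 - c) + E * m ≤ N := by
    have h2 : E * (m + 1) ≤ D * (m + 1) := Nat.mul_le_mul_right _ hED
    rw [mul_add, mul_one] at h2
    omega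
  rw [Nat.add_sub_cancel] at hn₁ ⊢
  refine ⟨?_, ?_⟩
  · rw [hE]
    refine Nat.add_le_add_left ((Nat.le_div_iff_mul_le (by omega)).2 ?_) _
    omega
  have : NeZero N := ⟨by omega⟩
  have heN : (m + 1 - c) + max 2 E * m ≤ N := by
    rcases max_choice 2 E with h | h <;> rw [h] <;> omega
  let φ : Fin n₁ ⊕ Fin (n₂ - n₁) ≃ Fin N ⊕ Fin E :=
    (finSumFinEquiv.trans (finCongr (by omega))).trans finSumFinEquiv.symm
  let ι : Fin n₁ ↪ Fin N := Fin.castLEEmb (by omega)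
  have hφ : ∀ i, φ (Sum.inl i) = Sum.inl (ι i) := by
    intro i
    rw [Equiv.trans_apply, Equiv.symm_apply_eq]
    ext
    simp [ι]
  choose a ha using fun M : {M : Finset (Fin n₁) // M.Nonempty} =>
    exists_arc_start (N := N) (m := m) (by omega) (M.2.map (f := ι))
  obtain ⟨row, hrow, hspan⟩ := exists_row_one_mem_span m N
  let Z : Finset (Fin n₁) → Fin n₁ ⊕ Fin (n₂ - n₁) → Finset (Fin N) := fun M x =>
    zeroSet m (m + 1 - c) (max 2 E) E (if h : M.Nonempty then a ⟨M, h⟩ else 0) (φ x)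
  have hZcard : ∀ M x, (Z M x).card = m := fun M x =>
    card_zeroSet _ (by omega) heN (le_max_right _ _) _
  have hZinl : ∀ M i, Z M (Sum.inl i) = cyclicArc (ι i) m := by
    intro M i
    simp only [Z, hφ]
    rfl
  have hsub : N - (m + 1) + 1 = N - m := by omega
  rw [hsub]
  refine ⟨fun i => row (cyclicArc (ι i) m), fun M j => row (Z M (Sum.inr j)), ?_, ?_, ?_⟩
  · intro M hMc I₁ hdisj I₂ hcard
    have hMne : M.Nonempty := Finset.card_pos.1 (by omega)
    have hT : ((M ∪ I₁).disjSum I₂).card = m + 1 := by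
      rw [Finset.card_disjSum, Finset.card_union_of_disjoint hdisj.symm]
      omega
    refine Submodule.span_mono ?_ (hspan _ (Z M) ((M ∪ I₁).disjSum I₂) hT
      (fun x _ => hZcard M x) fun I hI hne => ?_)
    · rintro _ ⟨x | j, hx, rfl⟩
      · exact Or.inl ⟨x, by simpa using hx, by simp only [hZinl]⟩
      · exact Or.inr ⟨j, by simpa using hx, rfl⟩
    · have h := card_filter_mem_zeroSet_add_card_le (m := m) (g := m + 1 - c) (e := max 2 E)
        (E := E) (a := a ⟨M, hMne⟩) (M := M.map ι) (by omega) (by omega) (le_max_left _ _)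
        (le_max_right _ _) heN (by simpa only [Finset.card_map, hMc] using ha ⟨M, hMne⟩)
        (T := ((M ∪ I₁).disjSum I₂).map φ.toEmbedding) (by rw [Finset.card_map, hT])
        (by
          intro i hi
          obtain ⟨l, hl, rfl⟩ := Finset.mem_map.1 hi
          rw [← hφ]
          exact Finset.mem_map_of_mem φ.toEmbedding
            (Finset.inl_mem_disjSum.2 (Finset.mem_union_left _ hl)))
        (I := I.map φ.toEmbedding) (Finset.map_subset_map.2 hI) (hne.map)
      rw [Finset.card_map] at h
      simpa only [Finset.forall_mem_map, Z, dif_pos hMne, Equiv.coe_toEmbedding] using h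
  · exact fun i => card_filter_ne_zero_le (hZcard ∅ (Sum.inl i))
      (by rw [hZinl]; exact hrow _ (hZinl ∅ i ▸ hZcard ∅ (Sum.inl i)))
  · exact fun M _ j => card_filter_ne_zero_le (hZcard M (Sum.inr j)) (hrow _ (hZcard M _))
end
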